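/- arXiv:2506.03858 — 5 statements merged into one kernel-verified Lean document; each statement's English description precedes it below -/
import Mathlib

section
/- For every R > 0 there exists a constant C > 0 such that for every integer n ≥ 1 and all s, t ∈ [-R, R], one has |h_n(s) h_n(t) - (1/(π √(2n))) (cos((s - t)√(2n)) + (-1)^n cos((s + t)√(2n)))| ≤ C/n. -/
noncomputable section

open MeasureTheory ProbabilityTheory Real Filter Finset

/-- Physicists' Hermite polynomials: `H 0 = 1`, `H 1 x = 2 * x`,
`H (n+2) x = 2 * x * H (n+1) x - 2 * (n+1) * H n x`. -/
def physHermite : ℕ → ℝ → ℝ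
  | 0, _ => 1
  | 1, x => 2 * x
  | (n + 2), x => 2 * x * physHermite (n + 1) x - 2 * (n + 1) * physHermite n x

/-- The `L²(ℝ)`-normalized Hermite functions. -/
def hermiteFun (n : ℕ) (x : ℝ) : ℝ :=
  physHermite n x * Real.exp (-x ^ 2 / 2) /
    Real.sqrt (n.factorial * 2 ^ n * Real.sqrt Real.pi)

lemma physHermite_succ (n : ℕ) (x : ℝ) :
    physHermite (n + 1) x = 2 * x * physHermite n x - 2 * n * physHermite (n - 1) x := by
  cases n with
  | zero => simp [physHermite]
  | succ k => simp [physHermite]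

lemma hasDerivAt_physHermite (n : ℕ) (x : ℝ) :
    HasDerivAt (physHermite n) (2 * n * physHermite (n - 1) x) x := by
  induction n using Nat.strong_induction_on with
  | _ n ih =>
    match n with
    | 0 =>
      have h : physHermite 0 = fun _ => (1 : ℝ) := by funext y; simp [physHermite]
      rw [h]
      simpa using hasDerivAt_const x (1 : ℝ)
    | 1 =>
      have h : physHermite 1 = fun y => 2 * y := by funext y; simp [physHermite]
      rw [h]
      simpa [physHermite] using (hasDerivAt_id x).const_mul (2 : ℝ)
    | k + 2 =>
      have h : physHermite (k + 2) = fun y =>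
          2 * y * physHermite (k + 1) y - 2 * (k + 1) * physHermite k y := by
        funext y; simp [physHermite]
      have h₁ := ih (k + 1) (by omega)
      have h₀ := ih k (by omega)
      rw [h]
      refine ((((hasDerivAt_id x).const_mul (2 : ℝ)).mul h₁).sub
        (h₀.const_mul (2 * ((k : ℝ) + 1)))).congr_deriv ?_
      have e := physHermite_succ k x
      simp only [Nat.add_sub_cancel, show k + 2 - 1 = k + 1 by omega, id]
      push_cast
      rw [e]
      ring

lemma physHermite_two_mul_add_one_zero (m : ℕ) : physHermite (2 * m + 1) 0 = 0 := by
  induction m with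
  | zero => simp [physHermite]
  | succ k ih =>
    rw [show 2 * (k + 1) + 1 = 2 * k + 1 + 1 + 1 by ring, physHermite_succ]
    simp [ih]

lemma physHermite_two_mul_zero (m : ℕ) :
    physHermite (2 * m) 0 * m.factorial = (-1) ^ m * (2 * m).factorial := by
  induction m with
  | zero => simp [physHermite]
  | succ k ih =>
    rw [show 2 * (k + 1) = 2 * k + 1 + 1 by ring, physHermite_succ, Nat.factorial_succ (2 * k + 1),
      Nat.factorial_succ (2 * k), Nat.factorial_succ k]
    push_cast
    rw [physHermite_two_mul_add_one_zero]
    linear_combination (-2 * (2 * (k : ℝ) + 1) * (k + 1)) * ih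

/-- The derivative of `hermiteFun n`. -/
def hermiteFunDeriv (n : ℕ) (x : ℝ) : ℝ :=
  (2 * n * physHermite (n - 1) x - x * physHermite n x) * Real.exp (-x ^ 2 / 2) /
    Real.sqrt (n.factorial * 2 ^ n * Real.sqrt Real.pi)

lemma hasDerivAt_exp_neg_sq_div_two (x : ℝ) :
    HasDerivAt (fun y : ℝ => Real.exp (-y ^ 2 / 2)) (-x * Real.exp (-x ^ 2 / 2)) x := by
  refine (((hasDerivAt_pow 2 x).neg.div_const 2).exp).congr_deriv ?_
  simp
  ring

lemma hasDerivAt_hermiteFun (n : ℕ) (x : ℝ) :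
    HasDerivAt (hermiteFun n) (hermiteFunDeriv n x) x := by
  refine (((hasDerivAt_physHermite n x).mul (hasDerivAt_exp_neg_sq_div_two x)).div_const
    (Real.sqrt (n.factorial * 2 ^ n * Real.sqrt Real.pi))).congr_deriv ?_
  unfold hermiteFunDeriv
  ring

lemma hasDerivAt_hermiteFunDeriv (n : ℕ) (x : ℝ) :
    HasDerivAt (hermiteFunDeriv n) ((x ^ 2 - 1 - 2 * n) * hermiteFun n x) x := by
  refine (((((hasDerivAt_physHermite (n - 1) x).const_mul (2 * (n : ℝ))).sub
    ((hasDerivAt_id x).mul (hasDerivAt_physHermite n x))).mul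
    (hasDerivAt_exp_neg_sq_div_two x)).div_const
    (Real.sqrt (n.factorial * 2 ^ n * Real.sqrt Real.pi))).congr_deriv ?_
  unfold hermiteFun
  cases n with
  | zero =>
    simp
    ring
  | succ k =>
    have e := physHermite_succ k x
    simp only [Nat.add_sub_cancel, id, Pi.sub_apply, Pi.mul_apply]
    rw [e]
    push_cast
    ring

/-- The square of `hermiteFun (2 * m)` at the origin. -/
def hermiteFunZeroSq (m : ℕ) : ℝ :=
  (2 * m).factorial / ((m.factorial : ℝ) ^ 2 * 4 ^ m * Real.sqrt Real.pi)

lemma hermiteFunZeroSq_nonneg (m : ℕ) : 0 ≤ hermiteFunZeroSq m := by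
  unfold hermiteFunZeroSq; positivity

lemma hermiteFun_two_mul_zero_sq (m : ℕ) : hermiteFun (2 * m) 0 ^ 2 = hermiteFunZeroSq m := by
  have h : physHermite (2 * m) 0 = (-1) ^ m * (2 * m).factorial / m.factorial := by
    rw [eq_div_iff (by positivity), physHermite_two_mul_zero]
  unfold hermiteFun hermiteFunZeroSq
  rw [div_pow, Real.sq_sqrt (by positivity), h, pow_mul (2 : ℝ)]
  have h1 : ((-1 : ℝ) ^ m) ^ 2 = 1 := by rw [← pow_mul, mul_comm, pow_mul]; simp
  have h2 : ((2 * m).factorial : ℝ) ≠ 0 := by positivity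
  norm_num [mul_pow, div_pow, h1]
  field_simp

lemma hermiteFunDeriv_two_mul_add_one_zero_sq (m : ℕ) :
    hermiteFunDeriv (2 * m + 1) 0 ^ 2 = 2 * (2 * m + 1) * hermiteFunZeroSq m := by
  have h : physHermite (2 * m) 0 = (-1) ^ m * (2 * m).factorial / m.factorial := by
    rw [eq_div_iff (by positivity), physHermite_two_mul_zero]
  unfold hermiteFunDeriv hermiteFunZeroSq
  rw [div_pow, Real.sq_sqrt (by positivity), Nat.add_sub_cancel, h, pow_succ (2 : ℝ), pow_mul (2 : ℝ),
    Nat.factorial_succ]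
  have h1 : ((-1 : ℝ) ^ m) ^ 2 = 1 := by rw [← pow_mul, mul_comm, pow_mul]; simp
  have h2 : ((2 * m).factorial : ℝ) ≠ 0 := by positivity
  norm_num [mul_pow, div_pow, h1]
  field_simp
  norm_num

lemma hermiteFunZeroSq_sq (m : ℕ) :
    hermiteFunZeroSq m ^ 2 * (Real.pi * (Real.Wallis.W m * (2 * m + 1))) = 1 := by
  rw [Real.Wallis.W_eq_factorial_ratio]
  unfold hermiteFunZeroSq
  have hp : Real.sqrt Real.pi ^ 2 = Real.pi := Real.sq_sqrt Real.pi_pos.le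
  have h2 : ((2 * m).factorial : ℝ) ≠ 0 := by positivity
  have h4 : (2 : ℝ) ^ (4 * m) = (4 ^ m) ^ 2 := by
    rw [← pow_mul, mul_comm m 2, pow_mul, pow_mul]; norm_num
  rw [div_pow, mul_pow, mul_pow, hp, h4]
  field_simp

lemma abs_hermiteFunZeroSq_sq_sub_le {m n : ℕ} (hn : 1 ≤ n) (hmn : n = 2 * m ∨ n = 2 * m + 1) :
    |hermiteFunZeroSq m ^ 2 - 2 / (Real.pi ^ 2 * n)| ≤ 1 / (n : ℝ) ^ 2 := by
  have hpi := Real.pi_gt_three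
  have hW := Real.Wallis.W_pos m
  have hU := Real.Wallis.W_le m
  have hL := Real.Wallis.le_W m
  have hx := hermiteFunZeroSq_sq m
  set p := hermiteFunZeroSq m ^ 2 with hp
  have hp0 : 0 ≤ p := sq_nonneg _
  have hn' : (1 : ℝ) ≤ n := by exact_mod_cast hn
  -- two-sided bounds coming from the Wallis product
  have lo : 2 / (Real.pi ^ 2 * (2 * m + 1)) ≤ p := by
    rw [div_le_iff₀ (by positivity)]
    have : p * (Real.pi * (Real.Wallis.W m * (2 * m + 1))) ≤
        p * (Real.pi * (Real.pi / 2 * (2 * m + 1))) := by gcongr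
    nlinarith
  have hi : p ≤ 2 * (2 * m + 2) / (Real.pi ^ 2 * (2 * m + 1) ^ 2) := by
    rw [le_div_iff₀ (by positivity)]
    have h : p * (Real.pi * (((2 * m + 1) / (2 * m + 2) * (Real.pi / 2)) * (2 * m + 1))) ≤
        p * (Real.pi * (Real.Wallis.W m * (2 * m + 1))) := by gcongr
    rw [hx] at h
    have e : p * (Real.pi * (((2 * m + 1) / (2 * m + 2) * (Real.pi / 2)) * (2 * m + 1))) =
        p * (Real.pi ^ 2 * (2 * m + 1) ^ 2) / (2 * (2 * m + 2)) := by
      field_simp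
    rw [e, div_le_one (by positivity)] at h
    exact h
  have hpi2 : (2 : ℝ) / Real.pi ^ 2 ≤ 1 := by
    rw [div_le_one (by positivity)]; nlinarith
  have hpi0 : (0 : ℝ) < 2 / Real.pi ^ 2 := by positivity
  have eq : (2 : ℝ) / (Real.pi ^ 2 * n) = 2 / Real.pi ^ 2 * (1 / n) := by field_simp
  have elo : (2 : ℝ) / (Real.pi ^ 2 * (2 * m + 1)) = 2 / Real.pi ^ 2 * (1 / (2 * m + 1)) := by
    field_simp
  have ehi : (2 : ℝ) * (2 * m + 2) / (Real.pi ^ 2 * (2 * m + 1) ^ 2) =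
      2 / Real.pi ^ 2 * ((2 * m + 2) / (2 * m + 1) ^ 2) := by field_simp
  rw [eq]
  rw [elo] at lo
  rw [ehi] at hi
  set c := (2 : ℝ) / Real.pi ^ 2
  have key : 1 / (n : ℝ) - 1 / (n : ℝ) ^ 2 ≤ 1 / (2 * m + 1) ∧
      ((2 : ℝ) * m + 2) / (2 * m + 1) ^ 2 ≤ 1 / n + 1 / (n : ℝ) ^ 2 := by
    rcases hmn with h | h
    · have h' : (2 : ℝ) * m = n := by rw [h]; push_cast; ring
      rw [h']
      have e₁ : 1 / ((n : ℝ) + 1) - (1 / (n : ℝ) - 1 / (n : ℝ) ^ 2) =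
          1 / ((n : ℝ) ^ 2 * (n + 1)) := by field_simp; ring
      have e₂ : 1 / (n : ℝ) - ((n : ℝ) + 2) / (n + 1) ^ 2 =
          1 / ((n : ℝ) * (n + 1) ^ 2) := by field_simp; ring
      have : 0 ≤ 1 / ((n : ℝ) ^ 2 * (n + 1)) := by positivity
      have : 0 ≤ 1 / ((n : ℝ) * (n + 1) ^ 2) := by positivity
      have : 0 ≤ 1 / (n : ℝ) ^ 2 := by positivity
      constructor <;> linarith
    · have h' : (2 : ℝ) * m = n - 1 := by rw [h]; push_cast; ring
      rw [h']
      have e₁ : ((n : ℝ) - 1 + 2) / (n - 1 + 1) ^ 2 = 1 / n + 1 / (n : ℝ) ^ 2 := by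
        rw [sub_add_cancel]; field_simp; ring
      have : 0 ≤ 1 / (n : ℝ) ^ 2 := by positivity
      refine ⟨?_, e₁.le⟩
      rw [sub_add_cancel]; linarith
  have h₁ := mul_le_mul_of_nonneg_left key.1 hpi0.le
  have h₂ := mul_le_mul_of_nonneg_left key.2 hpi0.le
  have h₃ : c * (1 / (n : ℝ) ^ 2) ≤ 1 * (1 / (n : ℝ) ^ 2) := by gcongr
  rw [abs_le]
  constructor <;> linarith

lemma sq_sub_le_abs_sq_sub_sq {a b : ℝ} (ha : 0 ≤ a) (hb : 0 ≤ b) :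
    (a - b) ^ 2 ≤ |a ^ 2 - b ^ 2| := by
  rcases le_total a b with h | h
  · rw [abs_of_nonpos (by nlinarith)]; nlinarith
  · rw [abs_of_nonneg (by nlinarith)]; nlinarith

lemma abs_hermiteFunZeroSq_sub_le {m n : ℕ} (hn : 1 ≤ n) (hmn : n = 2 * m ∨ n = 2 * m + 1) :
    |hermiteFunZeroSq m - 2 / (Real.pi * Real.sqrt (2 * n))| ≤ 1 / n := by
  have hn' : (1 : ℝ) ≤ n := by exact_mod_cast hn
  have h := abs_hermiteFunZeroSq_sq_sub_le hn hmn
  have h' := sq_sub_le_abs_sq_sub_sq (hermiteFunZeroSq_nonneg m)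
    (show 0 ≤ 2 / (Real.pi * Real.sqrt (2 * n)) by positivity)
  have e : (2 / (Real.pi * Real.sqrt (2 * n))) ^ 2 = 2 / (Real.pi ^ 2 * n) := by
    rw [div_pow, mul_pow, Real.sq_sqrt (by positivity)]
    field_simp
  rw [e] at h'
  refine abs_le_of_sq_le_sq ?_ (by positivity)
  rw [one_div, inv_pow, ← one_div]
  exact h'.trans h

lemma hermiteFunZeroSq_div_sqrt_le {m n : ℕ} (hn : 1 ≤ n) (hmn : n = 2 * m ∨ n = 2 * m + 1) :
    hermiteFunZeroSq m / Real.sqrt (2 * n) ≤ 1 / n := by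
  have hn' : (1 : ℝ) ≤ n := by exact_mod_cast hn
  have h := (abs_le.1 (abs_hermiteFunZeroSq_sq_sub_le hn hmn)).2
  have hpi := Real.pi_gt_three
  have h₁ : 2 / (Real.pi ^ 2 * n) ≤ 1 / (n : ℝ) := by
    rw [div_le_div_iff₀ (by positivity) (by positivity)]
    have : 2 ≤ Real.pi ^ 2 := by nlinarith
    nlinarith
  have h₂ : 1 / (n : ℝ) ^ 2 ≤ 1 / (n : ℝ) := by
    apply one_div_le_one_div_of_le (by positivity); nlinarith
  have h₃ : hermiteFunZeroSq m ^ 2 ≤ 2 / n := by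
    have : (2 : ℝ) / n = 1 / n + 1 / n := by ring
    linarith
  refine le_of_sq_le_sq ?_ (by positivity)
  rw [div_pow, Real.sq_sqrt (by positivity), div_le_iff₀ (by positivity)]
  refine h₃.trans (le_of_eq ?_)
  field_simp

section Oscillation

variable {f f' : ℝ → ℝ} {ω R P : ℝ}

/-- Growth bound for solutions of `f'' + ω ^ 2 f = (x ^ 2 - 1) f`, by Gronwall. -/
lemma abs_le_of_oscillator (hω : 1 ≤ ω) (hP : 0 ≤ P)
    (hf : ∀ x, HasDerivAt f (f' x) x)
    (hf' : ∀ x, HasDerivAt f' ((x ^ 2 - 1 - ω ^ 2) * f x) x)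
    (h0 : f 0 ^ 2 + (f' 0 / ω) ^ 2 = P ^ 2) {x : ℝ} (hx : x ∈ Set.Icc (-R) R) :
    |f x| ≤ Real.exp ((R ^ 2 + 1) * R) * P := by
  have hω0 : 0 < ω := by linarith
  have hR : 0 ≤ R := by have := hx.1; have := hx.2; linarith
  set L := 2 * (R ^ 2 + 1) with hL
  set F : ℝ → ℝ := fun y => f y ^ 2 + (f' y / ω) ^ 2 with hF
  set G : ℝ → ℝ := fun y => 2 / ω * ((y ^ 2 - 1) * (f y * (f' y / ω))) with hG
  have dF : ∀ y, HasDerivAt F (G y) y := fun y => by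
    refine (((hf y).pow 2).add (((hf' y).div_const ω).pow 2)).congr_deriv ?_
    simp only [hG]
    norm_num
    field_simp
    ring
  have bG : ∀ y ∈ Set.Icc (-R) R, |G y| ≤ L * F y := fun y hy => by
    have h1 : |y ^ 2 - 1| ≤ R ^ 2 + 1 := by
      have : y ^ 2 ≤ R ^ 2 := sq_le_sq' hy.1 hy.2
      rw [abs_le]; constructor <;> nlinarith
    have h2 : |f y * (f' y / ω)| ≤ F y := by
      simp only [hF]
      rw [abs_le]
      constructor <;> nlinarith [sq_nonneg (f y + f' y / ω), sq_nonneg (f y - f' y / ω),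
        sq_nonneg (f y), sq_nonneg (f' y / ω)]
    have h3 : 2 / ω ≤ 2 := by rw [div_le_iff₀ hω0]; linarith
    simp only [hG]
    rw [abs_mul, abs_mul, abs_of_pos (by positivity : 0 < 2 / ω)]
    calc 2 / ω * (|y ^ 2 - 1| * |f y * (f' y / ω)|) ≤ 2 * ((R ^ 2 + 1) * F y) := by gcongr
      _ = L * F y := by rw [hL]; ring
  have dE : ∀ (c y : ℝ), HasDerivAt (fun y => F y * Real.exp (c * y))
      ((G y + c * F y) * Real.exp (c * y)) y := fun c y => by
    refine ((dF y).mul (((hasDerivAt_id y).const_mul c).exp)).congr_deriv ?_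
    simp only [id]
    ring
  have cE : ∀ c : ℝ, ContinuousOn (fun y => F y * Real.exp (c * y)) (Set.Icc (-R) R) :=
    fun c y _ => (dE c y).continuousAt.continuousWithinAt
  have z : (0 : ℝ) ∈ Set.Icc (-R) R := ⟨by linarith, hR⟩
  have F0 : F 0 = P ^ 2 := h0
  have hFx : F x ≤ P ^ 2 * Real.exp (L * R) := by
    rcases le_total 0 x with hx0 | hx0
    · have := antitoneOn_of_deriv_nonpos (convex_Icc (-R) R) (cE (-L))
        (fun y _ => (dE _ y).differentiableAt.differentiableWithinAt) (fun y hy => by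
          rw [(dE _ y).deriv]
          have := (abs_le.1 (bG y (interior_subset hy))).2
          exact mul_nonpos_of_nonpos_of_nonneg (by linarith) (Real.exp_pos _).le) z hx hx0
      simp only [mul_zero, Real.exp_zero, mul_one, F0] at this
      calc F x = F x * Real.exp (-L * x) * Real.exp (L * x) := by
            rw [mul_assoc, ← Real.exp_add]; simp
        _ ≤ P ^ 2 * Real.exp (L * R) := by
            gcongr
            exact hx.2
    · have := monotoneOn_of_deriv_nonneg (convex_Icc (-R) R) (cE L)
        (fun y _ => (dE _ y).differentiableAt.differentiableWithinAt) (fun y hy => by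
          rw [(dE _ y).deriv]
          have := (abs_le.1 (bG y (interior_subset hy))).1
          exact mul_nonneg (by linarith) (Real.exp_pos _).le) hx z hx0
      simp only [mul_zero, Real.exp_zero, mul_one, F0] at this
      calc F x = F x * Real.exp (L * x) * Real.exp (L * (-x)) := by
            rw [mul_assoc, ← Real.exp_add]; simp
        _ ≤ P ^ 2 * Real.exp (L * R) := by
            gcongr
            linarith [hx.1]
  refine abs_le_of_sq_le_sq ?_ (by positivity)
  have e : (Real.exp ((R ^ 2 + 1) * R) * P) ^ 2 = P ^ 2 * Real.exp (L * R) := by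
    rw [mul_pow, ← Real.exp_nat_mul, hL]
    push_cast
    ring_nf
  rw [e]
  refine le_trans ?_ hFx
  simp only [hF]
  nlinarith [sq_nonneg (f' x / ω)]

lemma abs_sub_le_of_oscillator (hω : 1 ≤ ω) (hP : 0 ≤ P)
    (hf : ∀ x, HasDerivAt f (f' x) x)
    (hf' : ∀ x, HasDerivAt f' ((x ^ 2 - 1 - ω ^ 2) * f x) x)
    (h0 : f 0 ^ 2 + (f' 0 / ω) ^ 2 = P ^ 2) {x : ℝ} (hx : x ∈ Set.Icc (-R) R) :
    |f x - (f 0 * Real.cos (ω * x) + f' 0 / ω * Real.sin (ω * x))| ≤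
      2 * ((R ^ 2 + 1) * R * Real.exp ((R ^ 2 + 1) * R)) * P / ω := by
  have hω0 : 0 < ω := by linarith
  have hR : 0 ≤ R := by have := hx.1; have := hx.2; linarith
  set D := Real.exp ((R ^ 2 + 1) * R) with hD
  set A : ℝ → ℝ := fun y => f y * Real.cos (ω * y) - f' y / ω * Real.sin (ω * y) with hA
  set B : ℝ → ℝ := fun y => f y * Real.sin (ω * y) + f' y / ω * Real.cos (ω * y) with hB
  have dl : ∀ y, HasDerivAt (fun y => ω * y) ω y := fun y => by
    simpa using (hasDerivAt_id y).const_mul ω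
  have dA : ∀ y, HasDerivAt A (-(Real.sin (ω * y) / ω * ((y ^ 2 - 1) * f y))) y := fun y => by
    refine (((hf y).mul (dl y).cos).sub (((hf' y).div_const ω).mul (dl y).sin)).congr_deriv ?_
    field_simp
    ring
  have dB : ∀ y, HasDerivAt B (Real.cos (ω * y) / ω * ((y ^ 2 - 1) * f y)) y := fun y => by
    refine (((hf y).mul (dl y).sin).add (((hf' y).div_const ω).mul (dl y).cos)).congr_deriv ?_
    field_simp
    ring
  have bd : ∀ y ∈ Set.Icc (-R) R, ∀ c : ℝ, |c| ≤ 1 →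
      |c / ω * ((y ^ 2 - 1) * f y)| ≤ (R ^ 2 + 1) * D * P / ω := fun y hy c hc => by
    have h1 : |y ^ 2 - 1| ≤ R ^ 2 + 1 := by
      have : y ^ 2 ≤ R ^ 2 := sq_le_sq' hy.1 hy.2
      rw [abs_le]; constructor <;> nlinarith
    have h2 := abs_le_of_oscillator hω hP hf hf' h0 hy
    rw [abs_mul, abs_mul, abs_div, abs_of_pos hω0]
    calc |c| / ω * (|y ^ 2 - 1| * |f y|) ≤ 1 / ω * ((R ^ 2 + 1) * (D * P)) := by gcongr
      _ = _ := by ring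
  have z : (0 : ℝ) ∈ Set.Icc (-R) R := ⟨by linarith, hR⟩
  have hxR : |x - 0| ≤ R := by rw [sub_zero]; exact abs_le.2 hx
  have hC : 0 ≤ (R ^ 2 + 1) * D * P / ω := by positivity
  have hAx : |A x - A 0| ≤ (R ^ 2 + 1) * D * P / ω * R :=
    ((convex_Icc (-R) R).norm_image_sub_le_of_norm_hasDerivWithin_le
      (fun y _ => (dA y).hasDerivWithinAt) (fun y hy => by
        rw [norm_neg]; exact bd y hy _ (Real.abs_sin_le_one _)) z hx).trans
      (mul_le_mul_of_nonneg_left hxR hC)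
  have hBx : |B x - B 0| ≤ (R ^ 2 + 1) * D * P / ω * R :=
    ((convex_Icc (-R) R).norm_image_sub_le_of_norm_hasDerivWithin_le
      (fun y _ => (dB y).hasDerivWithinAt)
      (fun y hy => bd y hy _ (Real.abs_cos_le_one _)) z hx).trans
      (mul_le_mul_of_nonneg_left hxR hC)
  have A0 : A 0 = f 0 := by simp [hA]
  have B0 : B 0 = f' 0 / ω := by simp [hB]
  have e : f x - (f 0 * Real.cos (ω * x) + f' 0 / ω * Real.sin (ω * x)) =
      (A x - A 0) * Real.cos (ω * x) + (B x - B 0) * Real.sin (ω * x) := by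
    rw [A0, B0]
    simp only [hA, hB]
    linear_combination (-f x) * Real.sin_sq_add_cos_sq (ω * x)
  rw [e]
  calc _ ≤ |(A x - A 0) * Real.cos (ω * x)| + |(B x - B 0) * Real.sin (ω * x)| := abs_add_le _ _
    _ ≤ (R ^ 2 + 1) * D * P / ω * R * 1 + (R ^ 2 + 1) * D * P / ω * R * 1 := by
        rw [abs_mul, abs_mul]
        gcongr
        · exact Real.abs_cos_le_one _
        · exact Real.abs_sin_le_one _
    _ = _ := by ring

lemma abs_mul_sub_mul_le_of_oscillator (hω : 1 ≤ ω) (hP : 0 ≤ P)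
    (hf : ∀ x, HasDerivAt f (f' x) x)
    (hf' : ∀ x, HasDerivAt f' ((x ^ 2 - 1 - ω ^ 2) * f x) x)
    (h0 : f 0 ^ 2 + (f' 0 / ω) ^ 2 = P ^ 2) {s t : ℝ}
    (hs : s ∈ Set.Icc (-R) R) (ht : t ∈ Set.Icc (-R) R) :
    |f s * f t - (f 0 * Real.cos (ω * s) + f' 0 / ω * Real.sin (ω * s)) *
        (f 0 * Real.cos (ω * t) + f' 0 / ω * Real.sin (ω * t))| ≤
      2 * ((R ^ 2 + 1) * R * Real.exp ((R ^ 2 + 1) * R)) * (Real.exp ((R ^ 2 + 1) * R) + 1) *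
        (P ^ 2 / ω) := by
  have hω0 : 0 < ω := by linarith
  have hR : 0 ≤ R := by have := hs.1; have := hs.2; linarith
  have b := abs_le_of_oscillator hω hP hf hf' h0 hs
  have rs := abs_sub_le_of_oscillator hω hP hf hf' h0 hs
  have rt := abs_sub_le_of_oscillator hω hP hf hf' h0 ht
  have b0 : |f 0 * Real.cos (ω * t) + f' 0 / ω * Real.sin (ω * t)| ≤ P := by
    refine abs_le_of_sq_le_sq ?_ hP
    have := Real.sin_sq_add_cos_sq (ω * t)
    have e : (f 0 ^ 2 + (f' 0 / ω) ^ 2) * (Real.sin (ω * t) ^ 2 + Real.cos (ω * t) ^ 2) =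
      P ^ 2 := by rw [this, h0, mul_one]
    nlinarith [sq_nonneg (f 0 * Real.sin (ω * t) - f' 0 / ω * Real.cos (ω * t))]
  set u := f 0 * Real.cos (ω * s) + f' 0 / ω * Real.sin (ω * s)
  set v := f 0 * Real.cos (ω * t) + f' 0 / ω * Real.sin (ω * t)
  set D := Real.exp ((R ^ 2 + 1) * R)
  have hD : 0 < D := Real.exp_pos _
  calc |f s * f t - u * v| = |f s * (f t - v) + (f s - u) * v| := by ring_nf
    _ ≤ |f s| * |f t - v| + |f s - u| * |v| := by
        rw [← abs_mul, ← abs_mul]; exact abs_add_le _ _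
    _ ≤ (D * P) * (2 * ((R ^ 2 + 1) * R * D) * P / ω) +
        (2 * ((R ^ 2 + 1) * R * D) * P / ω) * P := by gcongr
    _ = _ := by ring

end Oscillation

lemma hermiteFun_initial {m n : ℕ} (hn : 1 ≤ n) (hmn : n = 2 * m ∨ n = 2 * m + 1) :
    hermiteFun n 0 ^ 2 + (hermiteFunDeriv n 0 / Real.sqrt (2 * n)) ^ 2 = hermiteFunZeroSq m ∧
    ∀ x y : ℝ, (hermiteFun n 0 * Real.cos x + hermiteFunDeriv n 0 / Real.sqrt (2 * n) * Real.sin x)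
      * (hermiteFun n 0 * Real.cos y + hermiteFunDeriv n 0 / Real.sqrt (2 * n) * Real.sin y) =
      hermiteFunZeroSq m / 2 * (Real.cos (x - y) + (-1) ^ n * Real.cos (x + y)) := by
  have hn' : (1 : ℝ) ≤ n := by exact_mod_cast hn
  have hsq : Real.sqrt (2 * n) ^ 2 = 2 * n := Real.sq_sqrt (by positivity)
  rcases hmn with h | h
  · have h1 : hermiteFunDeriv n 0 = 0 := by
      obtain ⟨k, hk⟩ : ∃ k, n - 1 = 2 * k + 1 := ⟨m - 1, by omega⟩
      simp [hermiteFunDeriv, hk, physHermite_two_mul_add_one_zero]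
    have h2 : hermiteFun n 0 ^ 2 = hermiteFunZeroSq m := by rw [h, hermiteFun_two_mul_zero_sq]
    have h3 : (-1 : ℝ) ^ n = 1 := by rw [h, pow_mul]; simp
    refine ⟨by rw [h1, h2]; simp, fun x y => ?_⟩
    rw [h1, h3, Real.cos_sub, Real.cos_add, ← h2]
    ring
  · have h1 : hermiteFun n 0 = 0 := by
      simp [hermiteFun, h, physHermite_two_mul_add_one_zero]
    have h2 : (hermiteFunDeriv n 0 / Real.sqrt (2 * n)) ^ 2 = hermiteFunZeroSq m := by
      rw [div_pow, hsq, div_eq_iff (by positivity), h, hermiteFunDeriv_two_mul_add_one_zero_sq]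
      push_cast
      ring
    have h3 : (-1 : ℝ) ^ n = -1 := by rw [h, pow_succ, pow_mul]; simp
    refine ⟨by rw [h1, h2]; simp, fun x y => ?_⟩
    rw [h1, h3, Real.cos_sub, Real.cos_add, ← h2]
    ring

theorem statement10 (R : ℝ) (hR : 0 < R) :
    ∃ C : ℝ, 0 < C ∧ ∀ n : ℕ, 1 ≤ n → ∀ s t : ℝ,
      s ∈ Set.Icc (-R) R → t ∈ Set.Icc (-R) R →
      |hermiteFun n s * hermiteFun n t -
          1 / (Real.pi * Real.sqrt (2 * n)) *
            (Real.cos ((s - t) * Real.sqrt (2 * n)) +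
              (-1 : ℝ) ^ n * Real.cos ((s + t) * Real.sqrt (2 * n)))| ≤ C / n := by
  set K := 2 * ((R ^ 2 + 1) * R * Real.exp ((R ^ 2 + 1) * R)) * (Real.exp ((R ^ 2 + 1) * R) + 1)
    with hK
  have hK0 : 0 < K := by positivity
  refine ⟨K + 1, by positivity, fun n hn s t hs ht => ?_⟩
  have hn' : (1 : ℝ) ≤ n := by exact_mod_cast hn
  obtain ⟨m, hmn⟩ : ∃ m, n = 2 * m ∨ n = 2 * m + 1 := ⟨n / 2, by omega⟩
  have hω : 1 ≤ Real.sqrt (2 * n) := Real.one_le_sqrt.2 (by linarith)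
  have hsq : Real.sqrt (2 * n) ^ 2 = 2 * n := Real.sq_sqrt (by positivity)
  obtain ⟨h0, hprod⟩ := hermiteFun_initial hn hmn
  have hp : Real.sqrt (hermiteFunZeroSq m) ^ 2 = hermiteFunZeroSq m :=
    Real.sq_sqrt (hermiteFunZeroSq_nonneg m)
  have main := abs_mul_sub_mul_le_of_oscillator hω (Real.sqrt_nonneg (hermiteFunZeroSq m))
    (hasDerivAt_hermiteFun n)
    (fun x => by rw [hsq]; exact hasDerivAt_hermiteFunDeriv n x) (by rw [hp, h0]) hs ht
  rw [hp, hprod, ← hK] at main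
  have main' := main.trans
    (mul_le_mul_of_nonneg_left (hermiteFunZeroSq_div_sqrt_le hn hmn) hK0.le)
  have hamp := abs_hermiteFunZeroSq_sub_le hn hmn
  set ω := Real.sqrt (2 * n)
  rw [← mul_sub, ← mul_add, mul_comm ω (s - t), mul_comm ω (s + t)] at main'
  set c := Real.cos ((s - t) * ω) + (-1) ^ n * Real.cos ((s + t) * ω) with hc
  have hc2 : |c| ≤ 1 + 1 := by
    refine (abs_add_le _ _).trans (add_le_add (Real.abs_cos_le_one _) ?_)
    rw [abs_mul, abs_pow, abs_neg, abs_one, one_pow, one_mul]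
    exact Real.abs_cos_le_one _
  have e : hermiteFun n s * hermiteFun n t - 1 / (Real.pi * ω) * c =
      (hermiteFun n s * hermiteFun n t - hermiteFunZeroSq m / 2 * c) +
        (hermiteFunZeroSq m - 2 / (Real.pi * ω)) * (c / 2) := by ring
  rw [e]
  calc _ ≤ K * (1 / n) + 1 / n * 1 := by
        refine (abs_add_le _ _).trans (add_le_add main' ?_)
        rw [abs_mul]
        gcongr
        rw [abs_div, abs_two]
        linarith
    _ = (K + 1) / n := by ring

end
end

section
/- Let d ≥ 2 be an integer and let x, y ∈ S^{d-1}. Then |x - y| ≤ 1 if and only if there exists a real number s ∈ [0, √3/2] such that x̂ = √(1+s) and ŷ = √(1-s). Moreover, in that case, s ≤ |x - y| ≤ (2/√3) s. -/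
noncomputable section

open MeasureTheory ProbabilityTheory Real Filter Finset

/-- `x̂ = (|x+y| + |x-y|)/2`. -/
def hatx {d : ℕ} (x y : EuclideanSpace ℝ (Fin d)) : ℝ := (‖x + y‖ + ‖x - y‖) / 2

/-- `ŷ = (|x+y| - |x-y|)/2`. -/
def haty {d : ℕ} (x y : EuclideanSpace ℝ (Fin d)) : ℝ := (‖x + y‖ - ‖x - y‖) / 2


/-- If `p, q ≥ 0` satisfy `p² + q² = 4` and `(p ± q) / 2 = √(1 ± s)` with `0 ≤ s ≤ √3 / 2`,
then `s = p q / 2`, `q ≤ 1` and `√3 ≤ p ≤ 2`. -/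
theorem bounds_of_half_sum_eq_sqrt {p q s : ℝ} (hp : 0 ≤ p) (hq : 0 ≤ q)
    (hpq : p ^ 2 + q ^ 2 = 4) (hs0 : 0 ≤ s) (hs : s ≤ √3 / 2)
    (h1 : (p + q) / 2 = √(1 + s)) (h2 : (p - q) / 2 = √(1 - s)) :
    s = p * q / 2 ∧ q ≤ 1 ∧ √3 ≤ p ∧ p ≤ 2 := by
  have h3 : √3 ^ 2 = 3 := Real.sq_sqrt (by norm_num)
  have e1 := Real.sq_sqrt (show (0 : ℝ) ≤ 1 + s by linarith)
  rw [← h1] at e1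
  have es : s = p * q / 2 := by nlinarith
  have hle : q ≤ p := by linarith [Real.sqrt_nonneg (1 - s)]
  have hs2 : s ^ 2 ≤ (√3 / 2) ^ 2 := pow_le_pow_left₀ hs0 hs 2
  have hprod : p ^ 2 * q ^ 2 ≤ 3 := by
    have : s ^ 2 = p ^ 2 * q ^ 2 / 4 := by rw [es]; ring
    linarith [show (√3 / 2) ^ 2 = √3 ^ 2 / 4 by ring]
  have hq2 : q ^ 2 ≤ 2 := by nlinarith
  have hq1 : q ^ 2 ≤ 1 := by
    have hp2 : p ^ 2 = 4 - q ^ 2 := by linarith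
    rw [hp2] at hprod
    nlinarith
  refine ⟨es, by nlinarith, Real.sqrt_le_iff.mpr ⟨hp, by linarith⟩, by nlinarith⟩

/-- If `p, q ≥ 0` satisfy `p² + q² = 4` and `q ≤ 1`, then `s = p q / 2` lies in `[0, √3 / 2]`
and `(p ± q) / 2 = √(1 ± s)`. -/
theorem exists_half_sum_eq_sqrt {p q : ℝ} (hp : 0 ≤ p) (hq : 0 ≤ q)
    (hpq : p ^ 2 + q ^ 2 = 4) (hq1 : q ≤ 1) :
    ∃ s : ℝ, s ∈ Set.Icc (0 : ℝ) (√3 / 2) ∧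
      (p + q) / 2 = √(1 + s) ∧ (p - q) / 2 = √(1 - s) := by
  have hqp : q ≤ p := by nlinarith
  refine ⟨p * q / 2, ⟨by positivity, ?_⟩, ?_, ?_⟩
  · have h : p * q ≤ √3 := by
      apply Real.le_sqrt_of_sq_le
      have hp2 : p ^ 2 = 4 - q ^ 2 := by linarith
      have hq2 : q ^ 2 ≤ 1 := by nlinarith
      rw [mul_pow, hp2]
      nlinarith
    linarith
  · rw [show 1 + p * q / 2 = ((p + q) / 2) ^ 2 by linarith]
    exact (Real.sqrt_sq (by linarith)).symm
  · rw [show 1 - p * q / 2 = ((p - q) / 2) ^ 2 by linarith]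
    exact (Real.sqrt_sq (by linarith)).symm

theorem statement14 (d : ℕ) (hd : 2 ≤ d) (x y : EuclideanSpace ℝ (Fin d))
    (hx : ‖x‖ = 1) (hy : ‖y‖ = 1) :
    (‖x - y‖ ≤ 1 ↔ ∃ s : ℝ, s ∈ Set.Icc (0 : ℝ) (Real.sqrt 3 / 2) ∧
        hatx x y = Real.sqrt (1 + s) ∧ haty x y = Real.sqrt (1 - s)) ∧
    ∀ s : ℝ, s ∈ Set.Icc (0 : ℝ) (Real.sqrt 3 / 2) →
      hatx x y = Real.sqrt (1 + s) → haty x y = Real.sqrt (1 - s) →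
      s ≤ ‖x - y‖ ∧ ‖x - y‖ ≤ 2 / Real.sqrt 3 * s := by
  have hpq : ‖x + y‖ ^ 2 + ‖x - y‖ ^ 2 = 4 := by
    have h := parallelogram_law_with_norm ℝ x y
    rw [hx, hy] at h
    linarith
  have hp := norm_nonneg (x + y)
  have hq := norm_nonneg (x - y)
  unfold hatx haty
  refine ⟨⟨exists_half_sum_eq_sqrt hp hq hpq, ?_⟩, ?_⟩
  · rintro ⟨s, ⟨hs0, hs⟩, h1, h2⟩
    exact (bounds_of_half_sum_eq_sqrt hp hq hpq hs0 hs h1 h2).2.1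
  · rintro s ⟨hs0, hs⟩ h1 h2
    obtain ⟨es, -, h3p, hp2⟩ := bounds_of_half_sum_eq_sqrt hp hq hpq hs0 hs h1 h2
    have h3 : 0 < √3 := by positivity
    refine ⟨by nlinarith, ?_⟩
    rw [es, div_mul_eq_mul_div, le_div_iff₀ h3]
    nlinarith

end
end

section
/- Let θ > 0 and let (c_n)_{n ≥ 1} be a nonnegative real sequence with Σ_{n ≥ 1} c_n < ∞. Define Υ_θ(t) = (Σ_{n ≥ 1} c_n min(1, n^θ t)²)^{1/2} for t ≥ 0. Then there exist constants 0 < A ≤ B, depending only on θ, such that A · S ≤ I ≤ B · S (as an inequality in [0, ∞], so in particular I < ∞ if and only if S < ∞), where I = ∫_0^1 Υ_θ(t) / (t (-log t)^{1/2}) dt and S = Σ_{p ≥ 1} (1/(p √(log(p+1)))) · (Σ_{n ≥ p} c_n)^{1/2}. -/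
noncomputable section

open MeasureTheory ProbabilityTheory Real Filter Finset


/-- The entropic-type integral `∫₀¹ Υ_θ(t) / (t √(-log t)) dt`, as a value in `[0,∞]`. -/
def upsilonIntegral (θ : ℝ) (c : ℕ → ℝ) : ENNReal :=
  ∫⁻ t in Set.Ioo (0 : ℝ) 1,
    ENNReal.ofReal
      (Real.sqrt (∑' n : ℕ, if 1 ≤ n then c n * min 1 ((n : ℝ) ^ θ * t) ^ 2 else 0) /
        (t * Real.sqrt (-Real.log t)))

/-- The Salem–Zygmund sum `Σ_{p ≥ 1} (1/(p √(log(p+1)))) (Σ_{n ≥ p} c_n)^{1/2}`,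
as a value in `[0,∞]`. -/
def szSum (c : ℕ → ℝ) : ENNReal :=
  ∑' p : ℕ, if 1 ≤ p then
    ENNReal.ofReal (1 / (p * Real.sqrt (Real.log (p + 1))) *
      Real.sqrt (∑' n : ℕ, if p ≤ n then c n else 0))
  else 0

/-- The tail `Σ_{n ≥ p} c_n`. -/
def tailSum (c : ℕ → ℝ) (p : ℕ) : ℝ := ∑' n : ℕ, if p ≤ n then c n else 0

/-- The function `Υ_θ(t) = (Σ_{n ≥ 1} c_n min(1, n^θ t)²)^{1/2}`. -/
def upsilon (θ : ℝ) (c : ℕ → ℝ) (t : ℝ) : ℝ :=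
  √(∑' n : ℕ, if 1 ≤ n then c n * min 1 ((n : ℝ) ^ θ * t) ^ 2 else 0)

/-- The weight `1 / (p √(log (p + 1)))` with `p` shifted by one. -/
def szWeight (p : ℕ) : ℝ := 1 / ((p + 1 : ℝ) * √(log (p + 2)))

lemma szWeight_nonneg (p : ℕ) : 0 ≤ szWeight p := by
  unfold szWeight; positivity

lemma szSum_eq_tsum (c : ℕ → ℝ) :
    szSum c = ∑' p : ℕ, ENNReal.ofReal (szWeight p * √(tailSum c (p + 1))) := by
  unfold szSum
  rw [tsum_eq_zero_add' ENNReal.summable]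
  simp only [nonpos_iff_eq_zero, one_ne_zero, if_false, zero_add]
  refine tsum_congr fun p => ?_
  rw [if_pos (Nat.le_add_left 1 p)]
  have h : (((p + 1 : ℕ) : ℝ) + 1) = p + 2 := by push_cast; ring
  rw [h]
  simp only [szWeight, tailSum, Nat.cast_add, Nat.cast_one]

lemma summable_ite_of_nonneg {c : ℕ → ℝ} (hc : ∀ n, 0 ≤ c n) (hs : Summable c) (p : ℕ) :
    Summable fun n => if p ≤ n then c n else 0 :=
  hs.of_nonneg_of_le (fun n => by split_ifs <;> simp [hc]) (fun n => by split_ifs <;> simp [hc])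

lemma tailSum_nonneg {c : ℕ → ℝ} (hc : ∀ n, 0 ≤ c n) (p : ℕ) : 0 ≤ tailSum c p :=
  tsum_nonneg fun n => by split_ifs <;> simp [hc]

/-- A form of Minkowski's inequality for sequences that are constant from some index on. -/
lemma sqrt_tsum_mul_sq_le {c : ℕ → ℝ} (hc : ∀ n, 0 ≤ c n) (hs : Summable c) {a : ℕ → ℝ}
    (ha : Monotone a) (ha0 : a 0 = 0) (p : ℕ) :
    √(∑' n, c n * a (min n p) ^ 2) ≤
      ∑ q ∈ Finset.range p, (a (q + 1) - a q) * √(tailSum c (q + 1)) := by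
  have hpos : ∀ n, 0 ≤ a n := fun n => ha0 ▸ ha (Nat.zero_le n)
  have hsum : ∀ p, Summable fun n => c n * a (min n p) ^ 2 := fun p =>
    (hs.mul_right (a p ^ 2)).of_nonneg_of_le (fun n => mul_nonneg (hc n) (sq_nonneg _))
      fun n => mul_le_mul_of_nonneg_left
        (pow_le_pow_left₀ (hpos _) (ha (min_le_right n p)) 2) (hc n)
  induction p with
  | zero => simp [ha0]
  | succ p ih =>
    rw [Finset.sum_range_succ]
    refine le_trans ?_ (add_le_add_left ih _)
    set T := tailSum c (p + 1) with hT
    set F := ∑' n, c n * a (min n p) ^ 2 with hF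
    have hT0 : 0 ≤ T := tailSum_nonneg hc _
    have hF0 : 0 ≤ F := tsum_nonneg fun n => mul_nonneg (hc n) (sq_nonneg _)
    have hst := summable_ite_of_nonneg hc hs (p + 1)
    have hstep : ∑' n, c n * a (min n (p + 1)) ^ 2 = F + T * (a (p + 1) ^ 2 - a p ^ 2) := by
      rw [hT, tailSum, hF, ← tsum_mul_right, ← (hsum p).tsum_add (hst.mul_right _)]
      refine tsum_congr fun n => ?_
      split_ifs with h
      · rw [min_eq_right h, min_eq_right (by omega)]; ring
      · rw [min_eq_left (by omega), min_eq_left (by omega)]; ring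
    have hlow : T * a p ^ 2 ≤ F := by
      rw [hT, tailSum, hF, ← tsum_mul_right]
      refine (hst.mul_right _).tsum_le_tsum (fun n => ?_) (hsum p)
      split_ifs with h
      · rw [min_eq_right (by omega)]
      · rw [zero_mul]; exact mul_nonneg (hc n) (sq_nonneg _)
    have hroot : √T * a p ≤ √F := by
      rw [← Real.sqrt_sq (hpos p), ← Real.sqrt_mul hT0]
      exact Real.sqrt_le_sqrt hlow
    have hd : 0 ≤ a (p + 1) - a p := sub_nonneg.2 (ha (Nat.le_succ p))
    rw [hstep]
    refine Real.sqrt_le_iff.2 ⟨by positivity, ?_⟩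
    have h1 : √T * (√T * a p) ≤ √T * √F := mul_le_mul_of_nonneg_left hroot (Real.sqrt_nonneg T)
    have h2 := mul_le_mul_of_nonneg_left h1 hd
    nlinarith [Real.sq_sqrt hT0, Real.sq_sqrt hF0]

lemma summable_upsilon {c : ℕ → ℝ} (hc : ∀ n, 0 ≤ c n) (hs : Summable c) (θ : ℝ) {t : ℝ}
    (ht : 0 ≤ t) :
    Summable fun n : ℕ => if 1 ≤ n then c n * min 1 ((n : ℝ) ^ θ * t) ^ 2 else 0 := by
  refine hs.of_nonneg_of_le (fun n => ?_) (fun n => ?_)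
  · split_ifs
    · exact mul_nonneg (hc n) (sq_nonneg _)
    · exact le_rfl
  · split_ifs
    · exact mul_le_of_le_one_right (hc n) (pow_le_one₀ (by positivity) (min_le_left _ _))
    · exact hc n

lemma upsilon_le {θ : ℝ} (hθ : 0 < θ) {c : ℕ → ℝ} (hc : ∀ n, 0 ≤ c n) (hs : Summable c) (p : ℕ)
    {t : ℝ} (ht0 : 0 ≤ t) (ht : t ≤ (p + 1 : ℝ) ^ (-θ)) :
    upsilon θ c t ≤ (p + 1 : ℝ) ^ (-θ) * ∑ q ∈ Finset.range (p + 1),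
      ((q + 1 : ℝ) ^ θ - (q : ℝ) ^ θ) * √(tailSum c (q + 1)) := by
  have hmono : Monotone fun n : ℕ => (n : ℝ) ^ θ := fun m n h =>
    Real.rpow_le_rpow (Nat.cast_nonneg m) (Nat.cast_le.2 h) hθ.le
  have key := sqrt_tsum_mul_sq_le hc hs hmono (by simp [hθ.ne']) (p + 1)
  have hp : (0 : ℝ) < (p + 1 : ℝ) ^ (-θ) := by positivity
  have hinv : (p + 1 : ℝ) ^ θ * (p + 1 : ℝ) ^ (-θ) = 1 := by
    rw [← Real.rpow_add (by positivity)]; simp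
  push_cast at key
  refine le_trans ?_ (mul_le_mul_of_nonneg_left key hp.le)
  rw [← Real.sqrt_sq hp.le, ← Real.sqrt_mul (sq_nonneg _), ← tsum_mul_left]
  refine Real.sqrt_le_sqrt ((summable_upsilon hc hs θ ht0).tsum_le_tsum (fun n => ?_) ?_)
  · split_ifs
    · have : min 1 ((n : ℝ) ^ θ * t) ≤ (p + 1 : ℝ) ^ (-θ) * (min (n : ℝ) (p + 1)) ^ θ := by
        rcases le_total (n : ℝ) (p + 1) with h | h
        · rw [min_eq_left h, mul_comm]
          exact (min_le_right _ _).trans (mul_le_mul_of_nonneg_right ht (by positivity))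
        · rw [min_eq_right h, mul_comm ((p + 1 : ℝ) ^ (-θ)), hinv]
          exact min_le_left _ _
      calc c n * min 1 ((n : ℝ) ^ θ * t) ^ 2
          ≤ c n * ((p + 1 : ℝ) ^ (-θ) * (min (n : ℝ) (p + 1)) ^ θ) ^ 2 :=
            mul_le_mul_of_nonneg_left (pow_le_pow_left₀ (by positivity) this 2) (hc n)
        _ = _ := by ring
    · exact mul_nonneg (sq_nonneg _) (mul_nonneg (hc n) (sq_nonneg _))
  · refine Summable.mul_left _ ((hs.mul_right (((p + 1 : ℝ) ^ θ) ^ 2)).of_nonneg_of_le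
      (fun n => mul_nonneg (hc n) (sq_nonneg _)) fun n => ?_)
    exact mul_le_mul_of_nonneg_left (pow_le_pow_left₀ (by positivity)
      (Real.rpow_le_rpow (by positivity) (min_le_right _ _) hθ.le) 2) (hc n)

lemma le_upsilon {θ : ℝ} (hθ : 0 < θ) {c : ℕ → ℝ} (hc : ∀ n, 0 ≤ c n) (hs : Summable c) (p : ℕ)
    {t : ℝ} (ht : (p + 2 : ℝ) ^ (-θ) ≤ t) :
    (2 : ℝ) ^ (-θ) * √(tailSum c (p + 1)) ≤ upsilon θ c t := by
  have h2 : (0 : ℝ) < (2 : ℝ) ^ (-θ) := by positivity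
  have ht0 : 0 ≤ t := le_trans (by positivity) ht
  rw [← Real.sqrt_sq h2.le, ← Real.sqrt_mul (sq_nonneg _), tailSum, ← tsum_mul_left]
  refine Real.sqrt_le_sqrt (((summable_ite_of_nonneg hc hs (p + 1)).mul_left _).tsum_le_tsum
    (fun n => ?_) (summable_upsilon hc hs θ ht0))
  by_cases h : p + 1 ≤ n
  · rw [if_pos h, if_pos (by omega), mul_comm]
    refine mul_le_mul_of_nonneg_left (pow_le_pow_left₀ h2.le (le_min ?_ ?_) 2) (hc n)
    · exact Real.rpow_le_one_of_one_le_of_nonpos (by norm_num) (by linarith)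
    · have hn : (p + 1 : ℝ) ≤ n := by exact_mod_cast h
      have hn0 : (0 : ℝ) < n := by linarith [(Nat.cast_nonneg p : (0 : ℝ) ≤ p)]
      calc (2 : ℝ) ^ (-θ) = (n : ℝ) ^ θ * (2 * n : ℝ) ^ (-θ) := by
            rw [Real.mul_rpow (by norm_num) hn0.le, mul_left_comm, ← Real.rpow_add hn0]; simp
        _ ≤ (n : ℝ) ^ θ * (p + 2 : ℝ) ^ (-θ) :=
            mul_le_mul_of_nonneg_left (Real.rpow_le_rpow_of_nonpos (by positivity)
              (by linarith) (by linarith)) (by positivity)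
        _ ≤ _ := mul_le_mul_of_nonneg_left ht (by positivity)
  · rw [if_neg h, mul_zero]
    split_ifs
    · exact mul_nonneg (hc n) (sq_nonneg _)
    · exact le_rfl

lemma lintegral_one_div_mul_sqrt_neg_log {a b : ℝ} (ha : 0 < a) (hab : a ≤ b) (hb : b ≤ 1) :
    ∫⁻ t in Set.Ico a b, ENNReal.ofReal (1 / (t * √(-log t))) =
      ENNReal.ofReal (2 * (√(-log a) - √(-log b))) := by
  have hcont : ContinuousOn (fun t => -2 * √(-log t)) (Set.Icc a b) :=
    continuousOn_const.mul (Real.continuousOn_log.mono fun x hx =>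
      (ha.trans_le hx.1).ne').neg.sqrt
  have hderiv : ∀ x ∈ Set.Ioo a b,
      HasDerivAt (fun t => -2 * √(-log t)) (1 / (x * √(-log x))) x := by
    intro x hx
    have hx0 : 0 < x := ha.trans hx.1
    have hl : 0 < -log x := neg_pos.2 (Real.log_neg hx0 (hx.2.trans_le hb))
    have hsq : √(-log x) ≠ 0 := (Real.sqrt_pos.2 hl).ne'
    convert! ((Real.hasDerivAt_log hx0.ne').neg.sqrt hl.ne').const_mul (-2) using 1
    simp only [Pi.neg_apply]
    field_simp
  have hnn : ∀ x ∈ Set.Ioc a b, 0 ≤ 1 / (x * √(-log x)) := fun x hx => by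
    have := ha.trans hx.1
    positivity
  have hint := intervalIntegral.integrableOn_deriv_of_nonneg hcont hderiv
    fun x hx => hnn x ⟨hx.1, hx.2.le⟩
  rw [setLIntegral_congr Ico_ae_eq_Ioc, ← ofReal_integral_eq_lintegral_ofReal hint
    ((ae_restrict_iff' measurableSet_Ioc).2 (ae_of_all _ hnn)),
    ← intervalIntegral.integral_of_le hab,
    intervalIntegral.integral_eq_sub_of_hasDerivAt_of_le hab hcont hderiv
      ((intervalIntegrable_iff_integrableOn_Ioc_of_le hab).2 hint)]
  congr 1
  ring

/-- The decomposition of `(0, 1)` along the points `p ^ (-θ)`. -/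
def cell (θ : ℝ) (p : ℕ) : Set ℝ := Set.Ico ((p + 2 : ℝ) ^ (-θ)) ((p + 1 : ℝ) ^ (-θ))

lemma antitone_rpow_neg {θ : ℝ} (hθ : 0 < θ) : Antitone fun p : ℕ => (p + 1 : ℝ) ^ (-θ) :=
  fun m n h => Real.rpow_le_rpow_of_nonpos (by positivity)
    (by have : (m : ℝ) ≤ n := Nat.cast_le.2 h
        linarith) (by linarith)

lemma iUnion_cell {θ : ℝ} (hθ : 0 < θ) : ⋃ p, cell θ p = Set.Ioo 0 1 := by
  ext t
  simp only [Set.mem_iUnion, cell, Set.mem_Ico, Set.mem_Ioo]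
  constructor
  · rintro ⟨p, h1, h2⟩
    exact ⟨lt_of_lt_of_le (by positivity) h1, h2.trans_le
      (by simpa using antitone_rpow_neg hθ (Nat.zero_le p))⟩
  · rintro ⟨h0, h1⟩
    have hlim : Tendsto (fun p : ℕ => (p + 1 : ℝ) ^ (-θ)) atTop (nhds 0) :=
      (tendsto_rpow_neg_atTop hθ).comp
        (tendsto_atTop_add_const_right _ 1 tendsto_natCast_atTop_atTop)
    have hex : ∃ p : ℕ, (p + 1 : ℝ) ^ (-θ) ≤ t :=
      ((hlim.eventually (gt_mem_nhds h0)).exists).imp fun _ h => le_of_lt h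
    classical
    have hspec := Nat.find_spec hex
    have hmin := fun m => Nat.find_min hex (m := m)
    rcases h : Nat.find hex with _ | m
    · rw [h] at hspec
      simp at hspec
      linarith
    · rw [h] at hspec
      refine ⟨m, ?_, not_le.1 (hmin m (by omega))⟩
      push_cast at hspec
      rwa [add_assoc, one_add_one_eq_two] at hspec

lemma lintegral_Ioo_eq_tsum_cell {θ : ℝ} (hθ : 0 < θ) (f : ℝ → ENNReal) :
    ∫⁻ t in Set.Ioo 0 1, f t = ∑' p, ∫⁻ t in cell θ p, f t := by
  rw [← iUnion_cell hθ]
  refine lintegral_iUnion (fun p => measurableSet_Ico) ?_ f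
  convert! (antitone_rpow_neg hθ).pairwise_disjoint_on_Ico_succ using 4 with p
  simp only [Nat.succ_eq_succ, Nat.cast_succ, add_assoc]
  norm_num

lemma sqrt_log_succ_sub_sqrt_log_le (p : ℕ) :
    √(log (p + 2)) - √(log (p + 1)) ≤ szWeight p := by
  have hp : (0 : ℝ) ≤ p := Nat.cast_nonneg p
  have hy : 0 < log (p + 2 : ℝ) := Real.log_pos (by linarith)
  have hx : 0 ≤ log (p + 1 : ℝ) := Real.log_nonneg (by linarith)
  have hd : log (p + 2 : ℝ) - log (p + 1) ≤ 1 / (p + 1) := by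
    rw [← Real.log_div (by positivity) (by positivity)]
    refine (Real.log_le_sub_one_of_pos (by positivity)).trans (le_of_eq ?_)
    field_simp
    ring
  have hsy := Real.sqrt_pos.2 hy
  have hle : √(log (p + 1 : ℝ)) ≤ √(log (p + 2)) :=
    Real.sqrt_le_sqrt (Real.log_le_log (by positivity) (by linarith))
  rw [szWeight, ← div_div, le_div_iff₀ hsy]
  refine le_trans ?_ hd
  nlinarith [Real.sq_sqrt hy.le, Real.sq_sqrt hx, Real.sqrt_nonneg (log (p + 1 : ℝ))]

lemma le_sqrt_log_succ_sub_sqrt_log (p : ℕ) :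
    szWeight p ≤ 4 * (√(log (p + 2)) - √(log (p + 1))) := by
  have hp : (0 : ℝ) ≤ p := Nat.cast_nonneg p
  have hy : 0 < log (p + 2 : ℝ) := Real.log_pos (by linarith)
  have hx : 0 ≤ log (p + 1 : ℝ) := Real.log_nonneg (by linarith)
  have hd : 1 / (p + 1) ≤ 2 * (log (p + 2 : ℝ) - log (p + 1)) := by
    rw [← Real.log_div (by positivity) (by positivity)]
    have h1 := Real.one_sub_inv_le_log_of_pos (x := (p + 2 : ℝ) / (p + 1)) (by positivity)
    have h2 : 1 / (p + 1 : ℝ) ≤ 2 * (1 - ((p + 2 : ℝ) / (p + 1))⁻¹) := by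
      rw [inv_div, div_le_iff₀ (by positivity)]
      field_simp
      linarith
    linarith
  have hsy := Real.sqrt_pos.2 hy
  have hle : √(log (p + 1 : ℝ)) ≤ √(log (p + 2)) :=
    Real.sqrt_le_sqrt (Real.log_le_log (by positivity) (by linarith))
  rw [szWeight, ← div_div, div_le_iff₀ hsy]
  refine hd.trans ?_
  nlinarith [Real.sq_sqrt hy.le, Real.sq_sqrt hx, Real.sqrt_nonneg (log (p + 1 : ℝ))]

lemma lintegral_cell {θ : ℝ} (hθ : 0 < θ) (p : ℕ) :
    ∫⁻ t in cell θ p, ENNReal.ofReal (1 / (t * √(-log t))) =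
      ENNReal.ofReal (2 * √θ * (√(log (p + 2)) - √(log (p + 1)))) := by
  have h : (p + 2 : ℝ) ^ (-θ) ≤ (p + 1 : ℝ) ^ (-θ) :=
    Real.rpow_le_rpow_of_nonpos (by positivity) (by linarith) (by linarith)
  rw [cell, lintegral_one_div_mul_sqrt_neg_log (by positivity) h
    (by simpa using antitone_rpow_neg hθ (Nat.zero_le p)),
    Real.log_rpow (by positivity), Real.log_rpow (by positivity), neg_mul, neg_mul, neg_neg,
    neg_neg, Real.sqrt_mul hθ.le, Real.sqrt_mul hθ.le]
  congr 1
  ring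

lemma rpow_succ_sub_rpow_le {θ : ℝ} (hθ : 0 < θ) (q : ℕ) :
    ((q + 1 : ℝ) ^ θ - (q : ℝ) ^ θ) * (q + 1 : ℝ) ^ (-θ) ≤ (1 + θ) / (q + 1) := by
  have hq : (0 : ℝ) ≤ q := Nat.cast_nonneg q
  have hq1 : (0 : ℝ) < q + 1 := by positivity
  have hx1 : (q / (q + 1) : ℝ) ≤ 1 := (div_le_one hq1).2 (by linarith)
  have h1 : (q / (q + 1) : ℝ) ^ (1 + θ) ≤ (q / (q + 1) : ℝ) ^ θ :=
    Real.rpow_le_rpow_of_exponent_ge' (by positivity) hx1 hθ.le (by linarith)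
  have h2 : 1 + (1 + θ) * (-1 / (q + 1 : ℝ)) ≤ (1 + -1 / (q + 1 : ℝ)) ^ (1 + θ) :=
    one_add_mul_self_le_rpow_one_add (by rw [le_div_iff₀ hq1]; linarith) (by linarith)
  have h3 : 1 + -1 / (q + 1 : ℝ) = q / (q + 1) := by field_simp; ring
  have h4 : ((q + 1 : ℝ) ^ θ - (q : ℝ) ^ θ) * (q + 1 : ℝ) ^ (-θ) = 1 - (q / (q + 1) : ℝ) ^ θ := by
    rw [Real.rpow_neg hq1.le, Real.div_rpow hq hq1.le]
    field_simp
  have h5 : (1 + θ) * (-1 / (q + 1 : ℝ)) = -((1 + θ) / (q + 1)) := by ring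
  rw [h4]
  rw [h3, h5] at h2
  linarith

lemma rpow_neg_div_le {θ : ℝ} (hθ : 0 < θ) (p : ℕ) :
    (p + 1 : ℝ) ^ (-θ) / (p + 1) ≤
      (2 + θ) / θ * ((p + 1 : ℝ) ^ (-θ) - (p + 2 : ℝ) ^ (-θ)) := by
  have hp : (0 : ℝ) ≤ p := Nat.cast_nonneg p
  set z : ℝ := θ / (p + 2) with hz
  have hz0 : 0 < z := by positivity
  have h1 : (p + 2 : ℝ) ^ (-θ) ≤ (p + 1 : ℝ) ^ (-θ) * (1 / (1 + z)) := by
    have hle : z ≤ θ * (log (p + 2 : ℝ) - log (p + 1)) := by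
      rw [← Real.log_div (by positivity) (by positivity)]
      have h := Real.one_sub_inv_le_log_of_pos (x := (p + 2 : ℝ) / (p + 1)) (by positivity)
      have h' : z = θ * (1 - ((p + 2 : ℝ) / (p + 1))⁻¹) := by
        rw [hz, inv_div]; field_simp; ring
      rw [h']
      exact mul_le_mul_of_nonneg_left h hθ.le
    have hexp : (p + 2 : ℝ) ^ (-θ) ≤ (p + 1 : ℝ) ^ (-θ) * Real.exp (-z) := by
      rw [Real.rpow_def_of_pos (by positivity), Real.rpow_def_of_pos (by positivity),
        ← Real.exp_add]
      exact Real.exp_le_exp.2 (by linarith)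
    refine hexp.trans (mul_le_mul_of_nonneg_left ?_ (by positivity))
    rw [Real.exp_neg, ← one_div]
    exact one_div_le_one_div_of_le (by positivity) (by linarith [Real.add_one_le_exp z])
  have h2 : 1 / (p + 1 : ℝ) ≤ (2 + θ) / θ * (1 - 1 / (1 + z)) := by
    have : (2 + θ) / θ * (1 - 1 / (1 + z)) = (2 + θ) / (p + 2 + θ) := by
      rw [hz]; field_simp; ring
    rw [this, div_le_div_iff₀ (by positivity) (by positivity)]
    nlinarith
  calc (p + 1 : ℝ) ^ (-θ) / (p + 1) = (p + 1 : ℝ) ^ (-θ) * (1 / (p + 1)) := by ring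
    _ ≤ (p + 1 : ℝ) ^ (-θ) * ((2 + θ) / θ * (1 - 1 / (1 + z))) :=
        mul_le_mul_of_nonneg_left h2 (by positivity)
    _ = (2 + θ) / θ * ((p + 1 : ℝ) ^ (-θ) - (p + 1 : ℝ) ^ (-θ) * (1 / (1 + z))) := by ring
    _ ≤ _ := mul_le_mul_of_nonneg_left (by linarith) (by positivity)

lemma tsum_ite_rpow_neg_div_le {θ : ℝ} (hθ : 0 < θ) (q : ℕ) :
    ∑' p : ℕ, (if q ≤ p then ENNReal.ofReal ((p + 1 : ℝ) ^ (-θ) / (p + 1)) else 0) ≤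
      ENNReal.ofReal ((2 + θ) / θ * (q + 1 : ℝ) ^ (-θ)) := by
  refine ENNReal.tsum_le_of_sum_range_le fun N => ?_
  have hreal : ∀ N : ℕ, ∑ p ∈ Finset.range N, (if q ≤ p then (p + 1 : ℝ) ^ (-θ) / (p + 1) else 0) ≤
      if q ≤ N then (2 + θ) / θ * ((q + 1 : ℝ) ^ (-θ) - (N + 1 : ℝ) ^ (-θ)) else 0 := by
    intro N
    induction N with
    | zero => by_cases h : q = 0 <;> simp [h]
    | succ N ih =>
      rw [Finset.sum_range_succ]
      have h := rpow_neg_div_le hθ N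
      have hcast : ((N + 1 : ℕ) : ℝ) + 1 = N + 2 := by push_cast; ring
      rw [hcast]
      by_cases h1 : q ≤ N
      · rw [if_pos h1] at ih ⊢
        rw [if_pos (by omega)]
        linarith
      · rw [if_neg h1] at ih ⊢
        by_cases h2 : q = N + 1
        · subst h2
          rw [if_pos le_rfl, hcast, sub_self, mul_zero]
          linarith
        · rw [if_neg (by omega)]
          linarith
  calc _ = ENNReal.ofReal
        (∑ p ∈ Finset.range N, (if q ≤ p then (p + 1 : ℝ) ^ (-θ) / (p + 1) else 0)) := by
        rw [ENNReal.ofReal_sum_of_nonneg]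
        · exact Finset.sum_congr rfl fun p _ => by split_ifs <;> simp
        · intro p _; split_ifs <;> positivity
    _ ≤ _ := by
        refine ENNReal.ofReal_le_ofReal ((hreal N).trans ?_)
        split_ifs
        · have : (0 : ℝ) ≤ (N + 1 : ℝ) ^ (-θ) := by positivity
          exact mul_le_mul_of_nonneg_left (by linarith) (by positivity)
        · positivity

lemma upsilonIntegral_eq_tsum {θ : ℝ} (hθ : 0 < θ) (c : ℕ → ℝ) :
    upsilonIntegral θ c = ∑' p, ∫⁻ t in cell θ p,
      ENNReal.ofReal (upsilon θ c t) * ENNReal.ofReal (1 / (t * √(-log t))) := by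
  rw [← lintegral_Ioo_eq_tsum_cell hθ, upsilonIntegral]
  refine lintegral_congr fun t => ?_
  rw [← ENNReal.ofReal_mul (by unfold upsilon; positivity), mul_one_div]
  rfl

lemma mul_szSum_le_upsilonIntegral {θ : ℝ} (hθ : 0 < θ) {c : ℕ → ℝ} (hc : ∀ n, 0 ≤ c n)
    (hs : Summable c) :
    ENNReal.ofReal ((2 : ℝ) ^ (-θ) * √θ / 2) * szSum c ≤ upsilonIntegral θ c := by
  rw [upsilonIntegral_eq_tsum hθ, szSum_eq_tsum, ← ENNReal.tsum_mul_left]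
  refine ENNReal.tsum_le_tsum fun p => ?_
  calc _ = ENNReal.ofReal ((2 : ℝ) ^ (-θ) * √θ / 2 * (szWeight p * √(tailSum c (p + 1)))) := by
        rw [← ENNReal.ofReal_mul (by positivity)]
    _ ≤ ENNReal.ofReal ((2 : ℝ) ^ (-θ) * √(tailSum c (p + 1)) *
          (2 * √θ * (√(log (p + 2)) - √(log (p + 1))))) := by
        refine ENNReal.ofReal_le_ofReal ?_
        have := mul_le_mul_of_nonneg_left (le_sqrt_log_succ_sub_sqrt_log p)
          (show 0 ≤ (2 : ℝ) ^ (-θ) * √θ / 2 * √(tailSum c (p + 1)) by positivity)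
        linarith
    _ = ∫⁻ t in cell θ p, ENNReal.ofReal ((2 : ℝ) ^ (-θ) * √(tailSum c (p + 1))) *
          ENNReal.ofReal (1 / (t * √(-log t))) := by
        rw [lintegral_const_mul' _ _ ENNReal.ofReal_ne_top, lintegral_cell hθ,
          ENNReal.ofReal_mul (by positivity)]
    _ ≤ _ := setLIntegral_mono' measurableSet_Ico fun t ht =>
        mul_le_mul_left (ENNReal.ofReal_le_ofReal (le_upsilon hθ hc hs p ht.1)) _

lemma lintegral_cell_upsilon_le {θ : ℝ} (hθ : 0 < θ) {c : ℕ → ℝ} (hc : ∀ n, 0 ≤ c n)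
    (hs : Summable c) (p : ℕ) :
    ∫⁻ t in cell θ p, ENNReal.ofReal (upsilon θ c t) * ENNReal.ofReal (1 / (t * √(-log t))) ≤
      ENNReal.ofReal ((p + 1 : ℝ) ^ (-θ) * (∑ q ∈ Finset.range (p + 1),
        ((q + 1 : ℝ) ^ θ - (q : ℝ) ^ θ) * √(tailSum c (q + 1))) * (2 * √θ * szWeight p)) := by
  have hd : ∀ q : ℕ, 0 ≤ (q + 1 : ℝ) ^ θ - (q : ℝ) ^ θ := fun q =>
    sub_nonneg.2 (Real.rpow_le_rpow (Nat.cast_nonneg q) (by linarith) hθ.le)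
  have hM : 0 ≤ (p + 1 : ℝ) ^ (-θ) * (∑ q ∈ Finset.range (p + 1),
      ((q + 1 : ℝ) ^ θ - (q : ℝ) ^ θ) * √(tailSum c (q + 1))) :=
    mul_nonneg (by positivity)
      (Finset.sum_nonneg fun q _ => mul_nonneg (hd q) (Real.sqrt_nonneg _))
  refine (setLIntegral_mono' measurableSet_Ico fun t ht =>
    mul_le_mul_left (ENNReal.ofReal_le_ofReal (upsilon_le hθ hc hs p
      (le_trans (by positivity) ht.1) ht.2.le)) _).trans ?_
  rw [lintegral_const_mul' _ _ ENNReal.ofReal_ne_top, ENNReal.ofReal_mul hM]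
  refine mul_le_mul_right ?_ _
  exact (lintegral_cell hθ p).trans_le (ENNReal.ofReal_le_ofReal
    (mul_le_mul_of_nonneg_left (sqrt_log_succ_sub_sqrt_log_le p) (by positivity)))

lemma upsilonIntegral_le_mul_szSum {θ : ℝ} (hθ : 0 < θ) {c : ℕ → ℝ} (hc : ∀ n, 0 ≤ c n)
    (hs : Summable c) :
    upsilonIntegral θ c ≤ ENNReal.ofReal (2 * √θ * (1 + θ) * ((2 + θ) / θ)) * szSum c := by
  have hd : ∀ q : ℕ, 0 ≤ (q + 1 : ℝ) ^ θ - (q : ℝ) ^ θ := fun q =>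
    sub_nonneg.2 (Real.rpow_le_rpow (Nat.cast_nonneg q) (by linarith) hθ.le)
  set K : ℕ → ℝ := fun q => ((q + 1 : ℝ) ^ θ - (q : ℝ) ^ θ) * √(tailSum c (q + 1)) *
    (2 * √θ) / √(log (q + 2)) with hK
  have hK0 : ∀ q, 0 ≤ K q := fun q => by
    have := hd q
    positivity
  rw [upsilonIntegral_eq_tsum hθ, szSum_eq_tsum, ← ENNReal.tsum_mul_left]
  calc _ ≤ ∑' p : ℕ, ∑' q : ℕ, ENNReal.ofReal (K q) *
        (if q ≤ p then ENNReal.ofReal ((p + 1 : ℝ) ^ (-θ) / (p + 1)) else 0) := by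
        refine ENNReal.tsum_le_tsum fun p => (lintegral_cell_upsilon_le hθ hc hs p).trans ?_
        refine le_trans ?_ (ENNReal.sum_le_tsum (Finset.range (p + 1)))
        rw [mul_right_comm, Finset.mul_sum, ENNReal.ofReal_sum_of_nonneg fun q _ => by
          have := hd q
          have := szWeight_nonneg p
          positivity]
        refine Finset.sum_le_sum fun q hq => ?_
        have hqp : q ≤ p := Nat.lt_succ_iff.1 (Finset.mem_range.1 hq)
        rw [if_pos hqp, ← ENNReal.ofReal_mul (hK0 q)]
        refine ENNReal.ofReal_le_ofReal ?_
        have hqp' : (q : ℝ) ≤ p := Nat.cast_le.2 hqp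
        have hq0 : (0 : ℝ) ≤ q := Nat.cast_nonneg q
        have hlog : 0 < √(log (q + 2 : ℝ)) := Real.sqrt_pos.2 (Real.log_pos (by linarith))
        have hw : szWeight p ≤ 1 / (p + 1) * (1 / √(log (q + 2))) := by
          rw [szWeight, ← one_div_mul_one_div]
          refine mul_le_mul_of_nonneg_left (one_div_le_one_div_of_le hlog ?_) (by positivity)
          exact Real.sqrt_le_sqrt (Real.log_le_log (by positivity) (by linarith))
        calc _ = ((p + 1 : ℝ) ^ (-θ) * (2 * √θ) *
              (((q + 1 : ℝ) ^ θ - (q : ℝ) ^ θ) * √(tailSum c (q + 1)))) * szWeight p := by ring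
          _ ≤ _ := mul_le_mul_of_nonneg_left hw (by have := hd q; positivity)
          _ = _ := by rw [hK]; ring
    _ = ∑' q : ℕ, ENNReal.ofReal (K q) *
        ∑' p : ℕ, (if q ≤ p then ENNReal.ofReal ((p + 1 : ℝ) ^ (-θ) / (p + 1)) else 0) := by
        rw [ENNReal.tsum_comm]
        exact tsum_congr fun q => ENNReal.tsum_mul_left
    _ ≤ _ := by
        refine ENNReal.tsum_le_tsum fun q => ?_
        refine (mul_le_mul_right (tsum_ite_rpow_neg_div_le hθ q) _).trans ?_
        rw [← ENNReal.ofReal_mul (hK0 q), ← ENNReal.ofReal_mul (by positivity)]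
        refine ENNReal.ofReal_le_ofReal ?_
        calc _ = (√(tailSum c (q + 1)) * (2 * √θ) / √(log (q + 2)) * ((2 + θ) / θ)) *
              (((q + 1 : ℝ) ^ θ - (q : ℝ) ^ θ) * (q + 1 : ℝ) ^ (-θ)) := by rw [hK]; ring
          _ ≤ _ := mul_le_mul_of_nonneg_left (rpow_succ_sub_rpow_le hθ q) (by positivity)
          _ = _ := by rw [szWeight]; field_simp

theorem statement16 (θ : ℝ) (hθ : 0 < θ) :
    ∃ A B : ℝ, 0 < A ∧ A ≤ B ∧
      ∀ c : ℕ → ℝ, (∀ n, 0 ≤ c n) → Summable c →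
        ENNReal.ofReal A * szSum c ≤ upsilonIntegral θ c ∧
        upsilonIntegral θ c ≤ ENNReal.ofReal B * szSum c := by
  refine ⟨(2 : ℝ) ^ (-θ) * √θ / 2, max ((2 : ℝ) ^ (-θ) * √θ / 2)
    (2 * √θ * (1 + θ) * ((2 + θ) / θ)), by positivity, le_max_left _ _, fun c hc hs => ⟨?_, ?_⟩⟩
  · exact mul_szSum_le_upsilonIntegral hθ hc hs
  · exact (upsilonIntegral_le_mul_szSum hθ hc hs).trans
      (mul_le_mul_left (ENNReal.ofReal_le_ofReal (le_max_right _ _)) _)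

end
end

section
/- Let β > -1 be a real number. There exists a constant C > 0 such that for every α ≥ 1, one has |∫_0^1 cos(α √t) t^{-1/2} (1 - t)^β dt| ≤ C α^{-(1+β)}. -/
noncomputable section

open MeasureTheory ProbabilityTheory Real Filter Finset

lemma intervalIntegrable_one_sub_rpow {β : ℝ} (hβ : -1 < β) (a b : ℝ) :
    IntervalIntegrable (fun s : ℝ => (1 - s) ^ β) volume a b := by
  simpa using (intervalIntegral.intervalIntegrable_rpow' (a := 1 - a) (b := 1 - b) hβ).comp_sub_left 1

lemma intervalIntegrable_one_sub_sq_rpow {β : ℝ} (hβ : -1 < β) :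
    IntervalIntegrable (fun s : ℝ => (1 - s ^ 2) ^ β) volume 0 1 := by
  have hc : ContinuousOn (fun s : ℝ => (1 + s) ^ β) (Set.uIcc 0 1) := by
    intro s hs
    rw [Set.uIcc_of_le zero_le_one] at hs
    exact (ContinuousAt.rpow_const (by fun_prop)
      (Or.inl (by linarith [hs.1]))).continuousWithinAt
  refine ((intervalIntegrable_one_sub_rpow hβ 0 1).mul_continuousOn hc).congr ?_
  intro s hs
  rw [Set.uIoc_of_le zero_le_one] at hs
  simp only
  rw [← mul_rpow (by linarith [hs.2]) (by linarith [hs.1])]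
  ring_nf

lemma HasDerivAt.comp_const_mul_real {V : ℝ → ℝ} {V' α s : ℝ} (h : HasDerivAt V V' (α * s)) :
    HasDerivAt (fun s => V (α * s)) (V' * α) s :=
  h.comp s (by simpa using (hasDerivAt_id' s).const_mul α)

lemma hasDerivAt_neg_cos (x : ℝ) : HasDerivAt (fun x => -cos x) (sin x) x := by
  simpa only [neg_neg] using (hasDerivAt_cos x).fun_neg

lemma one_sub_sq_pos {s : ℝ} (h0 : 0 ≤ s) (h1 : s < 1) : 0 < 1 - s ^ 2 := by nlinarith

lemma hasDerivAt_one_sub_sq_rpow (β : ℝ) {s : ℝ} (h0 : 0 ≤ s) (h1 : s < 1) :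
    HasDerivAt (fun s : ℝ => (1 - s ^ 2) ^ β) (-(2 * β * (s * (1 - s ^ 2) ^ (β - 1)))) s := by
  have h := (((hasDerivAt_id s).pow 2).const_sub 1).rpow_const (p := β)
    (Or.inl (one_sub_sq_pos h0 h1).ne')
  convert! h using 1
  simp
  ring

lemma hasDerivAt_mul_one_sub_sq_rpow (β : ℝ) {s : ℝ} (h0 : 0 ≤ s) (h1 : s < 1) :
    HasDerivAt (fun s : ℝ => s * (1 - s ^ 2) ^ β)
      ((1 - s ^ 2) ^ β - 2 * β * (s ^ 2 * (1 - s ^ 2) ^ (β - 1))) s := by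
  convert! (hasDerivAt_id s).mul (hasDerivAt_one_sub_sq_rpow β h0 h1) using 1
  simp
  ring

lemma one_sub_sq_rpow_le {β s : ℝ} (hβ : β ≤ 0) (h0 : 0 ≤ s) (h1 : s < 1) :
    (1 - s ^ 2) ^ β ≤ (1 - s) ^ β :=
  rpow_le_rpow_of_nonpos (by linarith) (by nlinarith) hβ

lemma continuousOn_one_sub_sq_rpow (β : ℝ) :
    ContinuousOn (fun s : ℝ => (1 - s ^ 2) ^ β) (Set.Ico 0 1) := fun _ hs =>
  (hasDerivAt_one_sub_sq_rpow β hs.1 hs.2).continuousAt.continuousWithinAt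

/-- Oscillatory integrals against a nonnegative increasing amplitude with an integrable power
singularity at the right endpoint. -/
lemma abs_integral_osc_le {γ : ℝ} (hγ : -1 < γ) {h h' v V : ℝ → ℝ}
    (hint : IntervalIntegrable h volume 0 1)
    (hder : ∀ s ∈ Set.Ico (0 : ℝ) 1, HasDerivAt h (h' s) s)
    (hcont : ContinuousOn h' (Set.Ico 0 1)) (hmono : ∀ s ∈ Set.Ico (0 : ℝ) 1, 0 ≤ h' s)
    (hnonneg : ∀ s ∈ Set.Ico (0 : ℝ) 1, 0 ≤ h s)
    (hle : ∀ s ∈ Set.Ico (0 : ℝ) 1, h s ≤ (1 - s) ^ γ)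
    (hV : ∀ x, HasDerivAt V (v x) x) (hv : Continuous v) (hv1 : ∀ x, |v x| ≤ 1)
    (hV1 : ∀ x, |V x| ≤ 1) {α : ℝ} (hα : 1 ≤ α) :
    |∫ s in (0 : ℝ)..1, h s * v (α * s)| ≤ (2 + 1 / (γ + 1)) * α ^ (-(1 + γ)) := by
  have hα0 : 0 < α := by linarith
  have hinv : 0 < α⁻¹ := inv_pos.2 hα0
  have hinv1 : α⁻¹ ≤ 1 := inv_le_one_of_one_le₀ hα
  obtain ⟨b, hb⟩ : ∃ b, b = 1 - α⁻¹ := ⟨_, rfl⟩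
  have hb0 : 0 ≤ b := by linarith
  have hb1 : b < 1 := by linarith
  have hsub : Set.Icc 0 b ⊆ Set.Ico (0 : ℝ) 1 := fun s hs => ⟨hs.1, hs.2.trans_lt hb1⟩
  have hu : Set.uIcc 0 b = Set.Icc 0 b := Set.uIcc_of_le hb0
  have hVc : Continuous V := continuous_iff_continuousAt.2 fun x => (hV x).continuousAt
  have hvi : IntervalIntegrable (fun s => h s * v (α * s)) volume 0 1 :=
    hint.mul_continuousOn (by fun_prop)
  have hi1 : IntervalIntegrable (fun s => h s * v (α * s)) volume 0 b :=
    hvi.mono_set (by rw [hu, Set.uIcc_of_le zero_le_one]; exact Set.Icc_subset_Icc_right hb1.le)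
  have hi2 : IntervalIntegrable (fun s => h s * v (α * s)) volume b 1 :=
    hvi.mono_set (by
      rw [Set.uIcc_of_le hb1.le, Set.uIcc_of_le zero_le_one]
      exact Set.Icc_subset_Icc_left hb0)
  have hh'i : IntervalIntegrable h' volume 0 b :=
    (hcont.mono (hu ▸ hsub)).intervalIntegrable
  have hscale : (α⁻¹) ^ (γ + 1) = α ^ (-(1 + γ)) := by
    rw [inv_rpow hα0.le, rpow_neg hα0.le, add_comm]
  have htail : |∫ s in b..1, h s * v (α * s)| ≤ 1 / (γ + 1) * α ^ (-(1 + γ)) := by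
    have h1 : |∫ s in b..1, h s * v (α * s)| ≤ ∫ s in b..1, (1 - s) ^ γ := by
      rw [← Real.norm_eq_abs]
      refine intervalIntegral.norm_integral_le_of_norm_le hb1.le ?_
        (intervalIntegrable_one_sub_rpow hγ b 1)
      have hne : ∀ᵐ s : ℝ, s ≠ 1 := by simp [ae_iff]
      filter_upwards [hne] with s hs1 hs
      have hs' : s ∈ Set.Ico (0 : ℝ) 1 := ⟨hb0.trans hs.1.le, lt_of_le_of_ne hs.2 hs1⟩
      rw [norm_mul, Real.norm_eq_abs, Real.norm_eq_abs, abs_of_nonneg (hnonneg s hs')]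
      calc h s * |v (α * s)| ≤ h s * 1 := by
            gcongr
            · exact hnonneg s hs'
            · exact hv1 _
        _ ≤ _ := by rw [mul_one]; exact hle s hs'
    refine h1.trans_eq ?_
    rw [intervalIntegral.integral_comp_sub_left (fun x => x ^ γ) 1, integral_rpow (Or.inl hγ), hb]
    have : γ + 1 ≠ 0 := by linarith
    simp only [sub_self, sub_sub_cancel, zero_rpow this, sub_zero, hscale]
    ring
  have hmain : |∫ s in (0 : ℝ)..b, h s * v (α * s)| ≤ 2 * α ^ (-(1 + γ)) := by
    have hVd : ∀ s, HasDerivAt (fun s => V (α * s)) (v (α * s) * α) s :=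
      fun s => (hV (α * s)).comp_const_mul_real
    have hparts := intervalIntegral.integral_mul_deriv_eq_deriv_mul
      (u := h) (u' := h') (v := fun s => V (α * s)) (v' := fun s => v (α * s) * α) (a := 0) (b := b)
      (fun s hs => hder s (hsub (hu ▸ hs))) (fun s _ => hVd s) hh'i
      (Continuous.intervalIntegrable (by fun_prop) _ _)
    have hftc : ∫ s in (0 : ℝ)..b, h' s = h b - h 0 :=
      intervalIntegral.integral_eq_sub_of_hasDerivAt
        (fun s hs => hder s (hsub (hu ▸ hs))) hh'i
    have hrem : |∫ s in (0 : ℝ)..b, h' s * V (α * s)| ≤ h b - h 0 := by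
      rw [← hftc, ← Real.norm_eq_abs]
      refine intervalIntegral.norm_integral_le_of_norm_le hb0 ?_ hh'i
      refine ae_of_all _ fun s hs => ?_
      have hs' := hmono s (hsub ⟨hs.1.le, hs.2⟩)
      rw [norm_mul, Real.norm_eq_abs, Real.norm_eq_abs, abs_of_nonneg hs']
      exact mul_le_of_le_one_right hs' (hV1 _)
    have h0 := hnonneg 0 ⟨le_rfl, one_pos⟩
    have hb' := hnonneg b ⟨hb0, hb1⟩
    have e1 : |h b * V (α * b)| ≤ h b := by
      rw [abs_mul, abs_of_nonneg hb']; exact mul_le_of_le_one_right hb' (hV1 _)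
    have e2 : |h 0 * V (α * 0)| ≤ h 0 := by
      rw [abs_mul, abs_of_nonneg h0]; exact mul_le_of_le_one_right h0 (hV1 _)
    have hhb : h b ≤ (α⁻¹) ^ γ := by simpa [hb] using hle b ⟨hb0, hb1⟩
    have key : |(∫ s in (0 : ℝ)..b, h s * v (α * s)) * α| ≤ 2 * (α⁻¹) ^ γ := by
      rw [← intervalIntegral.integral_mul_const]
      simp only [mul_assoc]
      rw [hparts]
      rw [abs_le] at *
      constructor <;> linarith
    rw [abs_mul, abs_of_pos hα0] at key
    rw [← hscale, rpow_add_one hinv.ne', ← mul_assoc, ← div_eq_mul_inv, le_div_iff₀ hα0]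
    exact key
  rw [← intervalIntegral.integral_add_adjacent_intervals hi1 hi2, add_mul]
  exact (abs_add_le _ _).trans (add_le_add hmain htail)

/-- The even Poisson-type integral `∫₀¹ (1 - s²)^β cos (α s) ds`. -/
def poissonCos (β α : ℝ) : ℝ := ∫ s in (0 : ℝ)..1, (1 - s ^ 2) ^ β * cos (α * s)

/-- The odd companion `∫₀¹ s (1 - s²)^β sin (α s) ds` of `poissonCos`. -/
def poissonSin (β α : ℝ) : ℝ := ∫ s in (0 : ℝ)..1, s * (1 - s ^ 2) ^ β * sin (α * s)

lemma intervalIntegrable_mul_one_sub_sq_rpow {β : ℝ} (hβ : -1 < β) :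
    IntervalIntegrable (fun s : ℝ => s * (1 - s ^ 2) ^ β) volume 0 1 :=
  (intervalIntegrable_one_sub_sq_rpow hβ).continuousOn_mul continuousOn_id

lemma abs_poissonCos_le_of_nonpos {β α : ℝ} (hβ : -1 < β) (hβ0 : β ≤ 0) (hα : 1 ≤ α) :
    |poissonCos β α| ≤ (2 + 1 / (β + 1)) * α ^ (-(1 + β)) := by
  refine abs_integral_osc_le hβ (intervalIntegrable_one_sub_sq_rpow hβ)
    (fun s hs => hasDerivAt_one_sub_sq_rpow β hs.1 hs.2) ?_ ?_ ?_
    (fun s hs => one_sub_sq_rpow_le hβ0 hs.1 hs.2)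
    hasDerivAt_sin continuous_cos abs_cos_le_one abs_sin_le_one hα
  · have := continuousOn_one_sub_sq_rpow (β - 1)
    fun_prop
  · intro s hs
    have h1 := mul_nonneg hs.1 (rpow_nonneg (one_sub_sq_pos hs.1 hs.2).le (β - 1))
    nlinarith
  · exact fun s hs => rpow_nonneg (one_sub_sq_pos hs.1 hs.2).le _

lemma abs_poissonSin_le_of_nonpos {β α : ℝ} (hβ : -1 < β) (hβ0 : β ≤ 0) (hα : 1 ≤ α) :
    |poissonSin β α| ≤ (2 + 1 / (β + 1)) * α ^ (-(1 + β)) := by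
  refine abs_integral_osc_le (V := fun x => -cos x) hβ (intervalIntegrable_mul_one_sub_sq_rpow hβ)
    (fun s hs => hasDerivAt_mul_one_sub_sq_rpow β hs.1 hs.2) ?_ ?_ ?_ ?_
    hasDerivAt_neg_cos continuous_sin abs_sin_le_one
    (fun x => by simpa using abs_cos_le_one x) hα
  · have h1 := continuousOn_one_sub_sq_rpow (β - 1)
    have h2 := continuousOn_one_sub_sq_rpow β
    fun_prop
  · intro s hs
    have h1 := mul_nonneg (sq_nonneg s) (rpow_nonneg (one_sub_sq_pos hs.1 hs.2).le (β - 1))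
    have h2 := rpow_nonneg (one_sub_sq_pos hs.1 hs.2).le β
    nlinarith
  · exact fun s hs => mul_nonneg hs.1 (rpow_nonneg (one_sub_sq_pos hs.1 hs.2).le _)
  · intro s hs
    exact (mul_le_of_le_one_left (rpow_nonneg (one_sub_sq_pos hs.1 hs.2).le _) hs.2.le).trans
      (one_sub_sq_rpow_le hβ0 hs.1 hs.2)

lemma continuous_one_sub_sq_rpow {β : ℝ} (hβ : 0 ≤ β) :
    Continuous fun s : ℝ => (1 - s ^ 2) ^ β :=
  (by fun_prop : Continuous fun s : ℝ => 1 - s ^ 2).rpow_const fun _ => Or.inr hβ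

lemma poissonCos_add_one_mul {β : ℝ} (hβ : -1 < β) (α : ℝ) :
    poissonCos (β + 1) α * α = 2 * (β + 1) * poissonSin β α := by
  have hVd : ∀ s, HasDerivAt (fun s => sin (α * s)) (cos (α * s) * α) s :=
    fun s => (hasDerivAt_sin (α * s)).comp_const_mul_real
  have hint : IntervalIntegrable (fun s : ℝ => -(2 * (β + 1) * (s * (1 - s ^ 2) ^ β)))
      volume 0 1 := ((intervalIntegrable_mul_one_sub_sq_rpow hβ).const_mul _).neg
  have hparts := intervalIntegral.integral_mul_deriv_eq_deriv_mul_of_hasDerivAt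
    (u := fun s : ℝ => (1 - s ^ 2) ^ (β + 1)) (v := fun s => sin (α * s))
    (v' := fun s => cos (α * s) * α) (a := 0) (b := 1)
    (continuous_one_sub_sq_rpow (by linarith)).continuousOn
    (by fun_prop) (fun s hs => by
      have hs' : s ∈ Set.Ioo (0 : ℝ) 1 := by simpa using hs
      simpa using hasDerivAt_one_sub_sq_rpow (β + 1) hs'.1.le hs'.2)
    (fun s _ => hVd s) hint (Continuous.intervalIntegrable (by fun_prop) _ _)
  have hne : β + 1 ≠ 0 := by linarith
  simp only [one_pow, sub_self, zero_rpow hne, mul_zero, sin_zero, zero_mul, zero_sub,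
    neg_mul, intervalIntegral.integral_neg, neg_neg] at hparts
  rw [poissonCos, poissonSin, ← intervalIntegral.integral_mul_const,
    ← intervalIntegral.integral_const_mul]
  simpa only [mul_assoc] using hparts

lemma poissonSin_add_one_mul {β : ℝ} (hβ : -1 < β) (α : ℝ) :
    poissonSin (β + 1) α * α =
      (2 * β + 3) * poissonCos (β + 1) α - 2 * (β + 1) * poissonCos β α := by
  have hVd : ∀ s, HasDerivAt (fun s => -cos (α * s)) (sin (α * s) * α) s :=
    fun s => (hasDerivAt_neg_cos (α * s)).comp_const_mul_real
  have hne : β + 1 ≠ 0 := by linarith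
  have hi1 := intervalIntegrable_one_sub_sq_rpow hβ
  have hi2 := intervalIntegrable_one_sub_sq_rpow (β := β + 1) (by linarith)
  have hparts := intervalIntegral.integral_mul_deriv_eq_deriv_mul_of_hasDerivAt
    (u := fun s : ℝ => s * (1 - s ^ 2) ^ (β + 1)) (v := fun s => -cos (α * s))
    (u' := fun s : ℝ => (2 * β + 3) * (1 - s ^ 2) ^ (β + 1) - 2 * (β + 1) * (1 - s ^ 2) ^ β)
    (v' := fun s => sin (α * s) * α) (a := 0) (b := 1)
    (continuous_id.mul (continuous_one_sub_sq_rpow (by linarith))).continuousOn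
    (by fun_prop) (fun s hs => by
      have hs' : s ∈ Set.Ioo (0 : ℝ) 1 := by simpa using hs
      convert! hasDerivAt_mul_one_sub_sq_rpow (β + 1) hs'.1.le hs'.2 using 1
      rw [add_sub_cancel_right, rpow_add_one (one_sub_sq_pos hs'.1.le hs'.2).ne']
      ring)
    (fun s _ => hVd s) ((hi2.const_mul _).sub (hi1.const_mul _))
    (Continuous.intervalIntegrable (by fun_prop) _ _)
  simp only [one_pow, sub_self, zero_rpow hne, mul_zero, zero_mul, zero_sub,
    mul_neg, intervalIntegral.integral_neg, neg_neg] at hparts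
  have hc : ContinuousOn (fun s => cos (α * s)) (Set.uIcc 0 1) := by fun_prop
  rw [poissonCos, poissonSin, poissonCos, ← intervalIntegral.integral_mul_const,
    ← intervalIntegral.integral_const_mul, ← intervalIntegral.integral_const_mul,
    ← intervalIntegral.integral_sub ((hi2.mul_continuousOn hc).const_mul _)
      ((hi1.mul_continuousOn hc).const_mul _)]
  simpa only [mul_assoc, sub_mul, neg_zero, zero_add] using hparts

lemma abs_le_of_abs_mul_le {x C α γ : ℝ} (hα : 0 < α)
    (h : |x * α| ≤ C * α ^ (-(1 + γ))) : |x| ≤ C * α ^ (-(1 + (γ + 1))) := by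
  have e : -(1 + (γ + 1)) = -(1 + γ) - 1 := by ring
  rw [abs_mul, abs_of_pos hα] at h
  rwa [e, rpow_sub_one hα.ne', ← mul_div_assoc, le_div_iff₀ hα]

lemma exists_poisson_bound {β : ℝ} (hβ : -1 < β) :
    ∃ C : ℝ, 0 < C ∧ ∀ α : ℝ, 1 ≤ α →
      |poissonCos β α| ≤ C * α ^ (-(1 + β)) ∧ |poissonSin β α| ≤ C * α ^ (-(1 + β)) := by
  obtain ⟨n, hn⟩ := exists_nat_ge β
  induction n generalizing β with
  | zero =>
    have : 0 < β + 1 := by linarith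
    have hβ0 : β ≤ 0 := by simpa using hn
    exact ⟨2 + 1 / (β + 1), by positivity, fun α hα =>
      ⟨abs_poissonCos_le_of_nonpos hβ hβ0 hα, abs_poissonSin_le_of_nonpos hβ hβ0 hα⟩⟩
  | succ n ih =>
    rcases le_or_gt β 0 with hβ0 | hβ0
    · exact ih hβ (hβ0.trans n.cast_nonneg)
    obtain ⟨γ, rfl⟩ : ∃ γ, β = γ + 1 := ⟨β - 1, by ring⟩
    have hγ : -1 < γ := by linarith
    obtain ⟨C, hC, hb⟩ := ih hγ (by push_cast at hn; linarith)
    have hk : 0 < 2 * (γ + 1) := by linarith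
    have hk' : 0 < 2 * γ + 3 := by linarith
    have hcos : ∀ α : ℝ, 1 ≤ α →
        |poissonCos (γ + 1) α| ≤ 2 * (γ + 1) * C * α ^ (-(1 + (γ + 1))) := fun α hα => by
      refine abs_le_of_abs_mul_le (by linarith) ?_
      rw [poissonCos_add_one_mul hγ, abs_mul, abs_of_pos hk, mul_assoc (2 * (γ + 1))]
      exact mul_le_mul_of_nonneg_left (hb α hα).2 hk.le
    have hsin : ∀ α : ℝ, 1 ≤ α → |poissonSin (γ + 1) α| ≤
        ((2 * γ + 3) * (2 * (γ + 1) * C) + 2 * (γ + 1) * C) * α ^ (-(1 + (γ + 1))) := fun α hα => by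
      refine abs_le_of_abs_mul_le (by linarith) ?_
      rw [poissonSin_add_one_mul hγ]
      refine (abs_sub _ _).trans ?_
      rw [abs_mul, abs_mul, abs_of_pos hk, abs_of_pos hk', add_mul _ _ (α ^ _),
        mul_assoc (2 * γ + 3), mul_assoc (2 * (γ + 1)) C]
      refine add_le_add (mul_le_mul_of_nonneg_left ((hcos α hα).trans ?_) hk'.le)
        (mul_le_mul_of_nonneg_left (hb α hα).1 hk.le)
      rw [← mul_assoc]
      refine mul_le_mul_of_nonneg_left (rpow_le_rpow_of_exponent_le hα (by linarith))
        (by positivity)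
    refine ⟨2 * (γ + 1) * C + ((2 * γ + 3) * (2 * (γ + 1) * C) + 2 * (γ + 1) * C), by positivity,
      fun α hα => ⟨(hcos α hα).trans ?_, (hsin α hα).trans ?_⟩⟩
    · exact mul_le_mul_of_nonneg_right (le_add_of_nonneg_right (by positivity)) (by positivity)
    · exact mul_le_mul_of_nonneg_right (le_add_of_nonneg_left (by positivity)) (by positivity)

lemma integral_cos_sqrt_eq (β α : ℝ) :
    ∫ t in (0 : ℝ)..1, Real.cos (α * Real.sqrt t) * t ^ (-(1 / 2 : ℝ)) * (1 - t) ^ β =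
      2 * poissonCos β α := by
  have himage : (fun s : ℝ => s ^ 2) '' Set.Ioo 0 1 = Set.Ioo 0 1 := by
    ext t
    constructor
    · rintro ⟨s, hs, rfl⟩
      exact ⟨pow_pos hs.1 2, by have := hs.1; have := hs.2; simp only; nlinarith⟩
    · intro ht
      exact ⟨√t, ⟨sqrt_pos.2 ht.1, (sqrt_lt' one_pos).2 (by simpa using ht.2)⟩, sq_sqrt ht.1.le⟩
  have hinj : Set.InjOn (fun s : ℝ => s ^ 2) (Set.Ioo 0 1) := fun s hs t ht hst =>
    (pow_left_inj₀ hs.1.le ht.1.le two_ne_zero).1 hst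
  have hcov := integral_image_eq_integral_abs_deriv_smul (f := fun s : ℝ => s ^ 2)
    (f' := fun s => 2 * s) measurableSet_Ioo
    (fun s _ => by simpa using (hasDerivAt_pow 2 s).hasDerivWithinAt) hinj
    (fun t => Real.cos (α * Real.sqrt t) * t ^ (-(1 / 2 : ℝ)) * (1 - t) ^ β)
  rw [himage] at hcov
  rw [poissonCos, ← intervalIntegral.integral_const_mul,
    intervalIntegral.integral_of_le zero_le_one, intervalIntegral.integral_of_le zero_le_one,
    integral_Ioc_eq_integral_Ioo, integral_Ioc_eq_integral_Ioo, hcov]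
  refine setIntegral_congr_fun measurableSet_Ioo fun s hs => ?_
  have hs0 : 0 < s := hs.1
  simp only [smul_eq_mul]
  rw [abs_of_pos (by positivity), sqrt_sq hs0.le, rpow_neg (by positivity), ← sqrt_eq_rpow,
    sqrt_sq hs0.le]
  field_simp

theorem statement17 (β : ℝ) (hβ : -1 < β) :
    ∃ C : ℝ, 0 < C ∧ ∀ α : ℝ, 1 ≤ α →
      |∫ t in (0 : ℝ)..1, Real.cos (α * Real.sqrt t) * t ^ (-(1 / 2 : ℝ)) * (1 - t) ^ β| ≤
        C * α ^ (-(1 + β)) := by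
  obtain ⟨C, hC, hb⟩ := exists_poisson_bound hβ
  refine ⟨2 * C, by positivity, fun α hα => ?_⟩
  rw [integral_cos_sqrt_eq, abs_mul, abs_two, mul_assoc]
  exact mul_le_mul_of_nonneg_left (hb α hα).1 zero_le_two

end
end

section
/- Let β > -1 be a real number and α₀ > 0. There exists ε ∈ [0, 1) such that for every α ≥ α₀, one has |∫_0^1 cos(α √t) t^{-1/2} (1 - t)^β dt| ≤ ε · ∫_0^1 t^{-1/2} (1 - t)^β dt. -/
noncomputable section

open MeasureTheory ProbabilityTheory Real Filter Finset

/-- Riemann–Lebesgue lemma for cosine integrals. -/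
theorem tendsto_integral_cos_mul_atTop {k : ℝ → ℝ} (hk : Integrable k) :
    Tendsto (fun α : ℝ => ∫ x, cos (α * x) * k x) atTop (nhds 0) := by
  have hlim := (Real.tendsto_integral_exp_smul_cocompact (fun x => (k x : ℂ))).mono_left
    atTop_le_cocompact
  have hdiv : Tendsto (fun α : ℝ => α / (2 * π)) atTop atTop :=
    tendsto_id.atTop_div_const (by positivity)
  have hre := (Complex.continuous_re.tendsto 0).comp (hlim.comp hdiv)
  rw [Complex.zero_re] at hre
  refine hre.congr fun α => ?_
  have hintegrable : Integrable fun x : ℝ => Real.fourierChar (-(x * (α / (2 * π)))) • (k x : ℂ) := by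
    have hcont : Continuous fun x : ℝ => Real.fourierChar (-(x * (α / (2 * π)))) := by fun_prop
    have hkc : Integrable fun x => (k x : ℂ) := hk.ofReal
    refine hkc.mono (hcont.aestronglyMeasurable.smul hkc.aestronglyMeasurable) ?_
    exact Eventually.of_forall fun x => by simp [Circle.norm_smul]
  simp only [Function.comp_apply]
  rw [← RCLike.re_eq_complex_re, ← integral_re hintegrable]
  refine integral_congr_ae (Eventually.of_forall fun x => ?_)
  have harg : 2 * π * -(x * (α / (2 * π))) = -(α * x) := by
    field_simp
  simp only [Circle.smul_def, Real.fourierChar_apply, harg, RCLike.re_eq_complex_re, smul_eq_mul,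
    Complex.re_mul_ofReal, Complex.exp_ofReal_mul_I_re, cos_neg]

theorem tendsto_integral_cos_mul_sqrt_atTop {h : ℝ → ℝ} (hh : IntegrableOn h (Set.Ioi 0)) :
    Tendsto (fun α : ℝ => ∫ t in Set.Ioi 0, cos (α * √t) * h t) atTop (nhds 0) := by
  have hk : IntegrableOn (fun x : ℝ => (|(2 : ℝ)| * x ^ ((2 : ℝ) - 1)) • h (x ^ (2 : ℝ)))
      (Set.Ioi 0) := (integrableOn_Ioi_comp_rpow_iff h two_ne_zero).2 hh
  refine (tendsto_integral_cos_mul_atTop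
    ((integrable_indicator_iff measurableSet_Ioi).2 hk)).congr fun α => ?_
  rw [← integral_comp_rpow_Ioi (fun t => cos (α * √t) * h t) (two_ne_zero (α := ℝ)),
    ← integral_indicator measurableSet_Ioi]
  refine integral_congr_ae (Eventually.of_forall fun x => ?_)
  by_cases hx : x ∈ Set.Ioi (0 : ℝ)
  · have hsqrt : √(x ^ (2 : ℝ)) = x := by
      rw [rpow_two, sqrt_sq (le_of_lt hx)]
    simp only [Set.indicator_of_mem hx, hsqrt, smul_eq_mul]
    ring
  · simp only [Set.indicator_of_notMem hx, mul_zero]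

theorem integrable_cos_mul {μ : Measure ℝ} {f : ℝ → ℝ} (hf : Integrable f μ) (α : ℝ) :
    Integrable (fun t => cos (α * √t) * f t) μ := by
  have hcont : Continuous fun t : ℝ => cos (α * √t) := by fun_prop
  exact hf.bdd_mul hcont.aestronglyMeasurable
    (Eventually.of_forall fun t => by simpa using abs_cos_le_one (α * √t))

theorem continuous_integral_cos_mul_sqrt {μ : Measure ℝ} {f : ℝ → ℝ} (hf : Integrable f μ) :
    Continuous fun α : ℝ => ∫ t, cos (α * √t) * f t ∂μ := by
  refine continuous_of_dominated (bound := fun t => ‖f t‖)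
    (fun α => (integrable_cos_mul hf α).aestronglyMeasurable) (fun α => ?_) hf.norm ?_
  · refine Eventually.of_forall fun t => ?_
    rw [norm_mul]
    exact mul_le_of_le_one_left (norm_nonneg _) (abs_cos_le_one _)
  · exact Eventually.of_forall fun t => by fun_prop

theorem abs_integral_cos_mul_sqrt_lt {f : ℝ → ℝ} (hf : IntegrableOn f (Set.Ioo 0 1))
    (hpos : ∀ t ∈ Set.Ioo (0 : ℝ) 1, 0 < f t) {α : ℝ} (hα : 0 < α) :
    |∫ t in Set.Ioo 0 1, cos (α * √t) * f t| < ∫ t in Set.Ioo 0 1, f t := by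
  have hintegrable : IntegrableOn (fun t => |cos (α * √t) * f t|) (Set.Ioo 0 1) :=
    (integrable_cos_mul hf α).abs
  refine abs_integral_le_integral_abs.trans_lt ?_
  rw [← sub_pos, ← integral_sub hf hintegrable]
  have hnonneg : ∀ t ∈ Set.Ioo (0 : ℝ) 1, 0 ≤ f t - |cos (α * √t) * f t| := fun t ht => by
    rw [abs_mul, abs_of_pos (hpos t ht), sub_nonneg]
    exact mul_le_of_le_one_left (hpos t ht).le (abs_cos_le_one _)
  rw [setIntegral_pos_iff_support_of_nonneg_ae
    ((ae_restrict_iff' measurableSet_Ioo).2 (Eventually.of_forall hnonneg)) (hf.sub hintegrable)]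
  have hδ : 0 < min 1 ((π / α) ^ 2) := by positivity
  refine lt_of_lt_of_le (b := volume (Set.Ioo (0 : ℝ) (min 1 ((π / α) ^ 2)))) (by simpa using hδ)
    (measure_mono fun t ht => ?_)
  have ht1 : t ∈ Set.Ioo (0 : ℝ) 1 := ⟨ht.1, ht.2.trans_le (min_le_left _ _)⟩
  have hsqrt : √t < π / α :=
    (sqrt_lt' (by positivity)).2 (ht.2.trans_le (min_le_right _ _))
  have hlt : α * √t < π := by rwa [lt_div_iff₀' hα] at hsqrt
  have hsin : 0 < sin (α * √t) :=
    sin_pos_of_pos_of_lt_pi (mul_pos hα (sqrt_pos.2 ht.1)) hlt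
  have hcos : |cos (α * √t)| < 1 := by
    rw [← sq_lt_one_iff_abs_lt_one]
    nlinarith [sin_sq_add_cos_sq (α * √t)]
  refine ⟨ne_of_gt ?_, ht1⟩
  beta_reduce
  rw [abs_mul, abs_of_pos (hpos t ht1), sub_pos]
  exact mul_lt_of_lt_one_left (hpos t ht1) hcos

theorem integrableOn_rpow_mul_one_sub_rpow {a b : ℝ} (ha : -1 < a) (hb : -1 < b) :
    IntegrableOn (fun t : ℝ => t ^ a * (1 - t) ^ b) (Set.Ioo 0 1) := by
  have hconv := (Complex.betaIntegral_convergent (u := ((a + 1 : ℝ) : ℂ)) (v := ((b + 1 : ℝ) : ℂ))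
    (by rw [Complex.ofReal_re]; linarith) (by rw [Complex.ofReal_re]; linarith)).norm
  rw [intervalIntegrable_iff_integrableOn_Ioo_of_le zero_le_one] at hconv
  refine hconv.congr_fun (fun t ht => ?_) measurableSet_Ioo
  have hsub : (1 - (t : ℂ)) = ((1 - t : ℝ) : ℂ) := by push_cast; rfl
  simp only [norm_mul]
  rw [hsub, Complex.norm_cpow_eq_rpow_re_of_pos ht.1,
    Complex.norm_cpow_eq_rpow_re_of_pos (sub_pos.2 ht.2)]
  simp

theorem exists_abs_integral_cos_mul_sqrt_le {f : ℝ → ℝ} (hf : IntegrableOn f (Set.Ioo 0 1))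
    (hpos : ∀ t ∈ Set.Ioo (0 : ℝ) 1, 0 < f t) {α₀ : ℝ} (hα₀ : 0 < α₀) :
    ∃ ε : ℝ, 0 ≤ ε ∧ ε < 1 ∧ ∀ α : ℝ, α₀ ≤ α →
      |∫ t in Set.Ioo 0 1, cos (α * √t) * f t| ≤ ε * ∫ t in Set.Ioo 0 1, f t := by
  set J : ℝ → ℝ := fun α => ∫ t in Set.Ioo 0 1, cos (α * √t) * f t with hJ
  set I : ℝ := ∫ t in Set.Ioo 0 1, f t with hI
  have hJlt : ∀ α, 0 < α → |J α| < I := fun α hα => abs_integral_cos_mul_sqrt_lt hf hpos hα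
  have hIpos : 0 < I := (abs_nonneg _).trans_lt (hJlt α₀ hα₀)
  have hJcont : Continuous J := continuous_integral_cos_mul_sqrt hf
  have hJlim : Tendsto J atTop (nhds 0) := by
    have hind : IntegrableOn ((Set.Ioo 0 1).indicator f) (Set.Ioi 0) :=
      ((integrable_indicator_iff measurableSet_Ioo).2 hf).integrableOn
    refine (tendsto_integral_cos_mul_sqrt_atTop hind).congr fun α => ?_
    have hmul : (fun t => cos (α * √t) * (Set.Ioo 0 1).indicator f t) =
        (Set.Ioo 0 1).indicator fun t => cos (α * √t) * f t :=
      funext fun t => (Set.indicator_mul_right _ (fun t => cos (α * √t)) f).symm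
    rw [hmul, setIntegral_indicator measurableSet_Ioo,
      Set.inter_eq_right.2 Set.Ioo_subset_Ioi_self]
  have hev : ∀ᶠ α in atTop, |J α| < 1 / 2 * I := by
    have := hJlim.abs
    rw [abs_zero] at this
    exact this.eventually_lt_const (by positivity)
  obtain ⟨M, hM⟩ := eventually_atTop.1 hev
  obtain ⟨α₁, hα₁, hmax⟩ := isCompact_Icc.exists_isMaxOn
    (Set.nonempty_Icc.2 (le_max_left α₀ M)) hJcont.abs.continuousOn
  refine ⟨max (1 / 2) (|J α₁| / I), le_max_of_le_left (by norm_num), max_lt (by norm_num) ?_,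
    fun α hα => ?_⟩
  · exact (div_lt_one hIpos).2 (hJlt α₁ (hα₀.trans_le hα₁.1))
  · rcases le_total α (max α₀ M) with h | h
    · rw [← div_le_iff₀ hIpos]
      exact le_max_of_le_right (div_le_div_of_nonneg_right (hmax ⟨hα, h⟩) hIpos.le)
    · exact (hM α ((le_max_right _ _).trans h)).le.trans
        (mul_le_mul_of_nonneg_right (le_max_left _ _) hIpos.le)

theorem statement18 (β : ℝ) (hβ : -1 < β) (α₀ : ℝ) (hα₀ : 0 < α₀) :
    ∃ ε : ℝ, 0 ≤ ε ∧ ε < 1 ∧ ∀ α : ℝ, α₀ ≤ α →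
      |∫ t in (0 : ℝ)..1, Real.cos (α * Real.sqrt t) * t ^ (-(1 / 2 : ℝ)) * (1 - t) ^ β| ≤
        ε * ∫ t in (0 : ℝ)..1, t ^ (-(1 / 2 : ℝ)) * (1 - t) ^ β := by
  have hf := integrableOn_rpow_mul_one_sub_rpow (a := -(1 / 2)) (by norm_num) hβ
  simp only [intervalIntegral.integral_of_le zero_le_one, integral_Ioc_eq_integral_Ioo, mul_assoc]
  exact exists_abs_integral_cos_mul_sqrt_le hf
    (fun t ht => mul_pos (rpow_pos_of_pos ht.1 _) (rpow_pos_of_pos (sub_pos.2 ht.2) _)) hα₀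

end
end
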